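/- arXiv:2108.06263 — 2 statements merged into one kernel-verified Lean document; each statement's English description precedes it below -/
import Mathlib

section
/- For every integer q ≥ 2, the border rank of the Kronecker square of the little Coppersmith–Winograd tensor is multiplicative: BR(cw_q ⊠ cw_q) = (q+2)² = BR(cw_q)². -/
open scoped BigOperators

noncomputable section

/-- A tensor `T ∈ ℂ^{ι₁} ⊗ ℂ^{ι₂} ⊗ ℂ^{ι₃}`, written in coordinates, has rank at most `r`
if it is a sum of `r` simple tensors. -/
def rankLE {ι₁ ι₂ ι₃ : Type*} (T : ι₁ → ι₂ → ι₃ → ℂ) (r : ℕ) : Prop :=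
  ∃ u : Fin r → ι₁ → ℂ, ∃ v : Fin r → ι₂ → ℂ, ∃ w : Fin r → ι₃ → ℂ,
    T = fun i j k => ∑ l, u l i * v l j * w l k

/-- The rank of a tensor. -/
def trank {ι₁ ι₂ ι₃ : Type*} (T : ι₁ → ι₂ → ι₃ → ℂ) : ℕ :=
  sInf {r | rankLE T r}

/-- The border rank of a tensor: the least `r` such that `T` is a limit of tensors of rank
at most `r` (closure in the Euclidean = product topology). -/
def brank {ι₁ ι₂ ι₃ : Type*} [Fintype ι₁] [Fintype ι₂] [Fintype ι₃]
    (T : ι₁ → ι₂ → ι₃ → ℂ) : ℕ :=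
  sInf {r | T ∈ closure {S : ι₁ → ι₂ → ι₃ → ℂ | rankLE S r}}

/-- The matrix multiplication tensor `M⟨a,b,c⟩ = Σ e_{ij} ⊗ e_{jk} ⊗ e_{ki}`. -/
def matMulTensor (a b c : ℕ) :
    (Fin a × Fin b) → (Fin b × Fin c) → (Fin c × Fin a) → ℂ :=
  fun x y z => if x.2 = y.1 ∧ y.2 = z.1 ∧ z.2 = x.1 then 1 else 0

/-- Kronecker product of tensors. -/
def kron {ι₁ ι₂ ι₃ κ₁ κ₂ κ₃ : Type*} (T : ι₁ → ι₂ → ι₃ → ℂ) (T' : κ₁ → κ₂ → κ₃ → ℂ) :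
    (ι₁ × κ₁) → (ι₂ × κ₂) → (ι₃ × κ₃) → ℂ :=
  fun i j k => T i.1 j.1 k.1 * T' i.2 j.2 k.2

/-- The little Coppersmith–Winograd tensor
`cw_q = Σ_{i=1}^q (e₀⊗eᵢ⊗eᵢ + eᵢ⊗e₀⊗eᵢ + eᵢ⊗eᵢ⊗e₀)`. -/
def cw (q : ℕ) : Fin (q + 1) → Fin (q + 1) → Fin (q + 1) → ℂ :=
  fun i j k =>
    if (i.val = 0 ∧ j = k ∧ j.val ≠ 0) ∨ (j.val = 0 ∧ i = k ∧ i.val ≠ 0) ∨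
       (k.val = 0 ∧ i = j ∧ i.val ≠ 0)
    then 1 else 0

/-- The big Coppersmith–Winograd tensor `CW_{m-2} ∈ ℂ^m ⊗ ℂ^m ⊗ ℂ^m` (for `m ≥ 3`). -/
def bigCW (m : ℕ) : Fin m → Fin m → Fin m → ℂ :=
  fun i j k =>
    if (i.val = 0 ∧ j.val = 0 ∧ k.val = m - 1) ∨
       (i.val = 0 ∧ j.val = m - 1 ∧ k.val = 0) ∨
       (i.val = m - 1 ∧ j.val = 0 ∧ k.val = 0) ∨
       (i.val = 0 ∧ j = k ∧ 1 ≤ j.val ∧ j.val ≤ m - 2) ∨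
       (j.val = 0 ∧ i = k ∧ 1 ≤ i.val ∧ i.val ≤ m - 2) ∨
       (k.val = 0 ∧ i = j ∧ 1 ≤ i.val ∧ i.val ≤ m - 2)
    then 1 else 0

/-- The skew Coppersmith–Winograd tensor `T_{skewcw,2} ∈ ℂ³⊗ℂ³⊗ℂ³`. -/
def skewCW2 : Fin 3 → Fin 3 → Fin 3 → ℂ :=
  fun i j k =>
    if (i = 0 ∧ j = 1 ∧ k = 1) ∨ (i = 0 ∧ j = 2 ∧ k = 2) ∨ (i = 1 ∧ j = 0 ∧ k = 1) ∨
       (i = 2 ∧ j = 0 ∧ k = 2) ∨ (i = 1 ∧ j = 2 ∧ k = 0)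
    then 1
    else if i = 2 ∧ j = 1 ∧ k = 0 then -1 else 0

/-- Action of a triple of linear maps (matrices) on a tensor. -/
def triApply {a b c a' b' c' : ℕ}
    (g₁ : Matrix (Fin a') (Fin a) ℂ) (g₂ : Matrix (Fin b') (Fin b) ℂ)
    (g₃ : Matrix (Fin c') (Fin c) ℂ) (T : Fin a → Fin b → Fin c → ℂ) :
    Fin a' → Fin b' → Fin c' → ℂ :=
  fun i j k => ∑ i', ∑ j', ∑ k', g₁ i i' * g₂ j j' * g₃ k k' * T i' j' k'

/-- The unit (diagonal) tensor `I_r ∈ ℂ^r ⊗ ℂ^r ⊗ ℂ^r`. -/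
def unitTensor (r : ℕ) : Fin r → Fin r → Fin r → ℂ :=
  fun i j k => if i = j ∧ j = k then 1 else 0

/-- The unit tensor `I_r = Σ_{ℓ=1}^r a_ℓ⊗b_ℓ⊗c_ℓ` embedded in `ℂ^a ⊗ ℂ^b ⊗ ℂ^c`
(for `r ≤ min{a,b,c}`). -/
def unitIn (a b c r : ℕ) : Fin a → Fin b → Fin c → ℂ :=
  fun i j k => if i.val = j.val ∧ j.val = k.val ∧ i.val < r then 1 else 0

/-- The subrank `Q(T)`: largest `r` so that linear maps take `T` to the unit tensor `I_r`. -/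
def subrank {a b c : ℕ} (T : Fin a → Fin b → Fin c → ℂ) : ℕ :=
  sSup {r | ∃ f : Matrix (Fin r) (Fin a) ℂ, ∃ g : Matrix (Fin r) (Fin b) ℂ,
    ∃ h : Matrix (Fin r) (Fin c) ℂ, triApply f g h T = unitTensor r}

/-- The `GL(A) × GL(B) × GL(C)`-orbit of a tensor. -/
def glOrbit {a b c : ℕ} (T : Fin a → Fin b → Fin c → ℂ) :
    Set (Fin a → Fin b → Fin c → ℂ) :=
  {S | ∃ g₁ : Matrix (Fin a) (Fin a) ℂ, ∃ g₂ : Matrix (Fin b) (Fin b) ℂ,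
    ∃ g₃ : Matrix (Fin c) (Fin c) ℂ, IsUnit g₁ ∧ IsUnit g₂ ∧ IsUnit g₃ ∧
      S = triApply g₁ g₂ g₃ T}

/-- The border subrank `Q̲(T)`: largest `r` (with `r ≤ min{a,b,c}`) such that `I_r` lies in
the closure of the `GL×GL×GL`-orbit of `T`. -/
def bsubrank {a b c : ℕ} (T : Fin a → Fin b → Fin c → ℂ) : ℕ :=
  sSup {r | r ≤ min a (min b c) ∧ unitIn a b c r ∈ closure (glOrbit T)}

/-- Multilinear rank in the `A`-factor: rank of the contraction `T_A : A* → B⊗C`. -/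
def mlA {a b c : ℕ} (T : Fin a → Fin b → Fin c → ℂ) : ℕ :=
  (Matrix.of fun (i : Fin a) (p : Fin b × Fin c) => T i p.1 p.2).rank

/-- Multilinear rank in the `B`-factor. -/
def mlB {a b c : ℕ} (T : Fin a → Fin b → Fin c → ℂ) : ℕ :=
  (Matrix.of fun (j : Fin b) (p : Fin a × Fin c) => T p.1 j p.2).rank

/-- Multilinear rank in the `C`-factor. -/
def mlC {a b c : ℕ} (T : Fin a → Fin b → Fin c → ℂ) : ℕ :=
  (Matrix.of fun (k : Fin c) (p : Fin a × Fin b) => T p.1 p.2 k).rank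

/-- `T` is `1_A`-generic: some contraction `T(α) : B* → C` has full rank `m`. -/
def oneAGeneric {m : ℕ} (T : Fin m → Fin m → Fin m → ℂ) : Prop :=
  ∃ α : Fin m → ℂ, (Matrix.of fun j k => ∑ i, α i * T i j k).rank = m

def oneBGeneric {m : ℕ} (T : Fin m → Fin m → Fin m → ℂ) : Prop :=
  ∃ β : Fin m → ℂ, (Matrix.of fun i k => ∑ j, β j * T i j k).rank = m

def oneCGeneric {m : ℕ} (T : Fin m → Fin m → Fin m → ℂ) : Prop :=
  ∃ γ : Fin m → ℂ, (Matrix.of fun i j => ∑ k, γ k * T i j k).rank = m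

/-- `T` is `1`-generic. -/
def oneGeneric {m : ℕ} (T : Fin m → Fin m → Fin m → ℂ) : Prop :=
  oneAGeneric T ∧ oneBGeneric T ∧ oneCGeneric T

/-- The symmetry Lie algebra `g̃_T ⊂ gl(A) ⊕ gl(B) ⊕ gl(C)` of a tensor, as a set. -/
def symLieSet {m : ℕ} (T : Fin m → Fin m → Fin m → ℂ) :
    Set (Matrix (Fin m) (Fin m) ℂ × Matrix (Fin m) (Fin m) ℂ × Matrix (Fin m) (Fin m) ℂ) :=
  {XYZ | ∀ i j k, (∑ i', XYZ.1 i i' * T i' j k) + (∑ j', XYZ.2.1 j j' * T i j' k) +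
    (∑ k', XYZ.2.2 k k' * T i j k') = 0}


noncomputable section
namespace CWK

/-- F_2 rank by Gaussian elimination on bitmasks. -/
def rk : ℕ → List ℕ → ℕ
  | 0, _ => 0
  | _ + 1, [] => 0
  | k + 1, r :: rs =>
    bif Nat.beq r 0 then rk k rs
    else 1 + rk k (rs.map fun x => bif Nat.testBit x (Nat.log2 r) then Nat.xor x r else x)

/-- bitmask of parities of the first `n` entries. -/
def mask : ℕ → (ℕ → ℤ) → ℕ
  | 0, _ => 0
  | n + 1, f => bif Nat.beq ((f n).natAbs % 2) 1 then Nat.xor (mask n f) (2 ^ n) else mask n f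

def bvec (m : ℕ) : ℕ → ZMod 2 := fun c => if Nat.testBit m c then 1 else 0

lemma bvec_xor (a b : ℕ) : bvec (Nat.xor a b) = bvec a + bvec b := by
  funext c
  have : Nat.xor a b = a ^^^ b := rfl
  simp only [bvec, this, Nat.testBit_xor, Pi.add_apply]
  cases a.testBit c <;> cases b.testBit c <;> simp <;> decide

lemma rk_le (k : ℕ) (l : List ℕ) :
    rk k l ≤ Module.finrank (ZMod 2) (Submodule.span (ZMod 2) {v | ∃ m ∈ l, v = bvec m}) := by
  induction k generalizing l with
  | zero => simp [rk]
  | succ k ih =>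
    cases l with
    | nil => simp [rk]
    | cons r rs =>
      have fin : ∀ l : List ℕ, FiniteDimensional (ZMod 2)
          (Submodule.span (ZMod 2) {v | ∃ m ∈ l, v = bvec m}) := by
        intro l
        apply FiniteDimensional.span_of_finite
        have : {v | ∃ m ∈ l, v = bvec m} = bvec '' {m | m ∈ l} := by
          ext v; simp [eq_comm]
        rw [this]
        exact (List.finite_toSet l).image _
      by_cases h0 : r = 0
      · have e : rk (k+1) (r :: rs) = rk k rs := by simp [rk, h0]
        rw [e]
        refine (ih rs).trans ?_
        have := fin (r :: rs)
        apply Submodule.finrank_mono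
        apply Submodule.span_mono
        rintro v ⟨m, hm, rfl⟩
        exact ⟨m, by simp [hm], rfl⟩
      · set rs' := rs.map fun x => bif Nat.testBit x (Nat.log2 r) then Nat.xor x r else x with hrs'
        have e : rk (k+1) (r :: rs) = 1 + rk k rs' := by
          have : Nat.beq r 0 = false := by
            cases hb : Nat.beq r 0
            · rfl
            · exact absurd (Nat.eq_of_beq_eq_true hb) h0
          simp [rk, this, hrs']
        rw [e]
        set S := Submodule.span (ZMod 2) {v | ∃ m ∈ rs', v = bvec m} with hS
        set W := Submodule.span (ZMod 2) {v | ∃ m ∈ (r :: rs), v = bvec m} with hW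
        have := fin rs'
        have := fin (r :: rs)
        have hrW : bvec r ∈ W := Submodule.subset_span ⟨r, by simp, rfl⟩
        have hSW : S ≤ W := by
          rw [hS, Submodule.span_le]
          rintro v ⟨m, hm, rfl⟩
          rw [hrs', List.mem_map] at hm
          obtain ⟨x, hx, rfl⟩ := hm
          have hxW : bvec x ∈ W := Submodule.subset_span ⟨x, by simp [hx], rfl⟩
          cases hb : Nat.testBit x (Nat.log2 r)
          · simpa using hxW
          · have := W.add_mem hxW hrW
            rw [← bvec_xor] at this
            exact this
        have hrb : Nat.testBit r (Nat.log2 r) = true := Nat.testBit_log2 h0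
        have hS0 : ∀ v ∈ S, v (Nat.log2 r) = 0 := by
          intro v hv
          rw [hS] at hv
          induction hv using Submodule.span_induction with
          | mem v hv =>
            obtain ⟨m, hm, rfl⟩ := hv
            rw [hrs', List.mem_map] at hm
            obtain ⟨x, hx, rfl⟩ := hm
            cases hb : Nat.testBit x (Nat.log2 r)
            · simp [bvec, hb]
            · have : Nat.xor x r = x ^^^ r := rfl
              simp [bvec, hb, this, Nat.testBit_xor, hrb]
          | zero => rfl
          | add x y _ _ hx hy => simp [hx, hy]
          | smul a x _ hx => simp [hx]
        have hlt : S < W := by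
          refine lt_of_le_of_ne hSW ?_
          intro h
          have := hS0 _ (h ▸ hrW)
          simp [bvec, hrb] at this
        have := Submodule.finrank_lt_finrank_of_lt hlt
        have h2 : rk k rs' ≤ Module.finrank (ZMod 2) S := ih rs'
        omega

lemma bvec_mask (n : ℕ) (f : ℕ → ℤ) (c : ℕ) :
    bvec (mask n f) c = if c < n then ((f c : ℤ) : ZMod 2) else 0 := by
  induction n with
  | zero => simp [mask, bvec]
  | succ n ih =>
    have key : bvec (2 ^ n) c = if c = n then 1 else 0 := by
      by_cases h : c = n
      · simp [bvec, h, Nat.testBit_two_pow]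
      · simp [bvec, h, Nat.testBit_two_pow, Ne.symm h]
    have hpar : ((f n : ℤ) : ZMod 2) = if Nat.beq ((f n).natAbs % 2) 1 then 1 else 0 := by
      rcases Int.even_or_odd (f n) with h | h
      · have h1 : (f n).natAbs % 2 = 0 := Nat.even_iff.1 (Int.natAbs_even.2 h)
        rw [h1]
        simpa using (ZMod.intCast_zmod_eq_zero_iff_dvd (f n) 2).2 (by exact_mod_cast h.two_dvd)
      · have h1 : (f n).natAbs % 2 = 1 := Nat.odd_iff.1 (Int.natAbs_odd.2 h)
        rw [h1]
        obtain ⟨m, hm⟩ := h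
        rw [hm]; push_cast
        have : (2 : ZMod 2) = 0 := by decide
        simp [this]
    cases hb : Nat.beq ((f n).natAbs % 2) 1
    · have e : mask (n+1) f = mask n f := by simp [mask, hb]
      rw [e, ih]
      by_cases h : c = n
      · subst h; simp [hpar, hb]
      · have : c < n + 1 ↔ c < n := by omega
        simp [this]
    · have e : mask (n+1) f = Nat.xor (mask n f) (2 ^ n) := by simp [mask, hb]
      rw [e, bvec_xor, Pi.add_apply, ih, key]
      by_cases h : c = n
      · subst h; simp [hpar, hb]
      · have : c < n + 1 ↔ c < n := by omega
        simp [this, h]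

/-- integer rows independent mod 2 are independent over ℂ -/
lemma li_of_mod2 {m n : ℕ} (f : Fin m → Fin n → ℤ)
    (h : LinearIndependent (ZMod 2) (fun i c => ((f i c : ℤ) : ZMod 2))) :
    LinearIndependent ℂ (fun i c => ((f i c : ℤ) : ℂ)) := by
  set M : Matrix (Fin m) (Fin n) (ZMod 2) := fun i c => ((f i c : ℤ) : ZMod 2) with hM
  have hsurj : ∃ B : Matrix (Fin n) (Fin m) (ZMod 2), M * B = 1 := by
    rw [← Matrix.mulVec_surjective_iff_exists_right_inverse]
    have hr : M.rank = m := by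
      have := LinearIndependent.rank_matrix (M := M) h
      simpa using this
    have : LinearMap.range M.mulVecLin = ⊤ := by
      apply Submodule.eq_top_of_finrank_eq
      rw [← Matrix.rank, hr]; simp
    rw [LinearMap.range_eq_top] at this
    exact this
  obtain ⟨B, hB⟩ := hsurj
  let MZ : Matrix (Fin m) (Fin n) ℤ := fun i c => f i c
  let BZ : Matrix (Fin n) (Fin m) ℤ := fun i c => ((B i c).val : ℤ)
  have h1 : (MZ * BZ).map (Int.castRingHom (ZMod 2)) = 1 := by
    rw [Matrix.map_mul, ← hB]
    congr 1
    ext i c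
    change (((B i c).val : ℤ) : ZMod 2) = B i c
    simp
  have hdet : (Int.castRingHom (ZMod 2)) (MZ * BZ).det = 1 := by
    rw [RingHom.map_det, RingHom.mapMatrix_apply, h1, Matrix.det_one]
  have hne : (MZ * BZ).det ≠ 0 := by
    intro h0; rw [h0] at hdet; simp at hdet
  have hC : ((MZ * BZ).map (Int.castRingHom ℂ)).det ≠ 0 := by
    have e := RingHom.map_det (Int.castRingHom ℂ) (MZ * BZ)
    rw [RingHom.mapMatrix_apply] at e
    rw [← e]
    simpa using hne
  rw [Matrix.map_mul] at hC
  have hinj : Function.Injective (fun v => Matrix.vecMul v (MZ.map (Int.castRingHom ℂ))) := by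
    have hu : IsUnit (MZ.map (Int.castRingHom ℂ) * BZ.map (Int.castRingHom ℂ)) := by
      rw [Matrix.isUnit_iff_isUnit_det]; exact isUnit_iff_ne_zero.2 hC
    have := Matrix.vecMul_injective_of_isUnit hu
    intro a b hab
    apply this
    simp only at hab ⊢
    rw [← Matrix.vecMul_vecMul, ← Matrix.vecMul_vecMul, hab]
  have := Matrix.vecMul_injective_iff.1 hinj
  exact this

theorem cert {κ : Type*} [Finite κ] (S : Submodule ℂ (κ → ℂ)) (n : ℕ) (e : ℕ → κ)
    (rows : List (ℕ → ℤ))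
    (h : ∀ r ∈ rows, ∃ v ∈ S, ∀ c < n, v (e c) = ((r c : ℤ) : ℂ)) (k R : ℕ)
    (hR : Nat.ble R (rk k (rows.map (mask n))) = true) :
    R ≤ Module.finrank ℂ S := by
  have hR' : R ≤ rk k (rows.map (mask n)) := Nat.le_of_ble_eq_true hR
  refine hR'.trans ((rk_le _ _).trans ?_)
  set Z : Set (ℕ → ZMod 2) := {v | ∃ m ∈ rows.map (mask n), v = bvec m} with hZ
  have : FiniteDimensional (ZMod 2) (Submodule.span (ZMod 2) Z) := by
    apply FiniteDimensional.span_of_finite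
    have : Z = bvec '' {m | m ∈ rows.map (mask n)} := by
      ext v; simp only [hZ, Set.mem_setOf_eq, Set.mem_image, eq_comm]
    rw [this]
    exact (List.finite_toSet _).image _
  obtain ⟨g, hg, -, hli⟩ := Submodule.exists_fun_fin_finrank_span_eq (ZMod 2) Z
  have hg' : ∀ i, ∃ r ∈ rows, g i = bvec (mask n r) := by
    intro i
    obtain ⟨m, hm, e⟩ := hg i
    rw [List.mem_map] at hm
    obtain ⟨r, hr, rfl⟩ := hm
    exact ⟨r, hr, e⟩
  choose rr hrr hgr using hg'
  have hli2 : LinearIndependent (ZMod 2)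
      (fun i (c : Fin n) => ((rr i c : ℤ) : ZMod 2)) := by
    rw [Fintype.linearIndependent_iff] at hli ⊢
    intro a ha
    apply hli a
    funext c
    simp only [Finset.sum_apply, Pi.smul_apply, Pi.zero_apply, hgr, bvec_mask]
    by_cases hc : c < n
    · have := congrFun ha ⟨c, hc⟩
      simpa [hc] using this
    · simp [hc]
  have hli3 := li_of_mod2 (fun i (c : Fin n) => rr i c) hli2
  choose v hvS hv using fun i => h (rr i) (hrr i)
  have hli4 : LinearIndependent ℂ (fun i => (⟨v i, hvS i⟩ : S)) := by
    let P : S →ₗ[ℂ] (Fin n → ℂ) :=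
      (LinearMap.funLeft ℂ ℂ (fun c : Fin n => e c)).comp S.subtype
    apply LinearIndependent.of_comp P
    convert hli3 using 1
    funext i c
    simp [P, LinearMap.funLeft_apply, hv i c c.2]
  have := hli4.fintype_card_le_finrank
  simpa using this

end CWK
end

noncomputable section
namespace CWK
open Module

def dl (s j : ℕ) : ℂ := if s = j then 1 else 0

/-- coordinates of `y ∧ e_s ∧ e_t` -/
def kz (y : ℕ → ℂ) (s t i j k : ℕ) : ℂ :=
  y i * (dl s j * dl t k - dl s k * dl t j) - y j * (dl s i * dl t k - dl s k * dl t i)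
    + y k * (dl s i * dl t j - dl s j * dl t i)

/-- integer version for sorted indices, cheap for the kernel -/
def kzI (y : ℕ → ℤ) (s t i j k : ℕ) : ℤ :=
  bif Nat.beq s j && Nat.beq t k then y i else
  bif Nat.beq s i && Nat.beq t k then Int.neg (y j) else
  bif Nat.beq s i && Nat.beq t j then y k else 0

lemma beq_dec (a b : ℕ) : Nat.beq a b = decide (a = b) := by
  by_cases h : a = b
  · subst h; simp [Nat.beq_refl]
  · cases hb : Nat.beq a b
    · simp [h]
    · exact absurd (Nat.eq_of_beq_eq_true hb) h

lemma kz_eq (y : ℕ → ℤ) (y' : ℕ → ℂ) (s t i j k : ℕ) (hst : s < t) (hij : i < j) (hjk : j < k)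
    (hi : y' i = y i) (hj : y' j = y j) (hk : y' k = y k) :
    kz y' s t i j k = ((kzI y s t i j k : ℤ) : ℂ) := by
  have hneg : ∀ x : ℤ, Int.neg x = -x := fun x => rfl
  simp only [kz, kzI, dl, beq_dec, hi, hj, hk]
  by_cases h1 : s = i
  · have h2 : s ≠ j := by omega
    have h3 : s ≠ k := by omega
    have h4 : t ≠ i := by omega
    by_cases h5 : t = k
    · have : t ≠ j := by omega
      simp only [h2, h3, h4, this, if_false, decide_false, Bool.false_and, Bool.and_false, cond_false]
      simp [h1, h5, hneg]
    · simp [← h1, h2, h3, h5]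
      by_cases h6 : t = j <;> simp [h6]
  · by_cases h2 : s = j
    · have h3 : s ≠ k := by omega
      have h4 : t ≠ j := by omega
      have h5 : t ≠ i := by omega
      simp [← h2, h3, Ne.symm h1, h1, h5]
      have : t ≠ s := by omega
      by_cases h6 : t = k <;> simp [h6, this]
    · by_cases h3 : s = k
      · have h4 : t ≠ j := by omega
        have h5 : t ≠ i := by omega
        have h6 : t ≠ k := by omega
        simp [h1, h2, h4, h5, h6]
      · simp [h1, h2, h3]

variable {β γ : Type} [Fintype β] [Fintype γ]

def Yc (φ : ℕ → γ → ℂ) (e : β × γ → ℂ) (b : β) (i : ℕ) : ℂ := ∑ c, φ i c * e (b, c)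

def Psi (φ : ℕ → γ → ℂ) (st : Fin 5 × Fin 5) :
    (β × γ → ℂ) →ₗ[ℂ] (Fin 5 × Fin 5 × Fin 5 × β → ℂ) where
  toFun e x := kz (Yc φ e x.2.2.2) st.1 st.2 x.1 x.2.1 x.2.2.1
  map_add' e e' := by
    funext x
    simp only [kz, Yc, Pi.add_apply, mul_add, Finset.sum_add_distrib]
    ring
  map_smul' a e := by
    funext x
    have : ∀ i b, ∑ c, φ i c * (a * e (b, c)) = a * ∑ c, φ i c * e (b, c) := by
      intro i b
      rw [Finset.mul_sum]
      exact Finset.sum_congr rfl fun c _ => by ring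
    simp only [kz, Yc, Pi.smul_apply, smul_eq_mul, this, RingHom.id_apply]
    ring

lemma Psi_apply (φ : ℕ → γ → ℂ) (st : Fin 5 × Fin 5) (e : β × γ → ℂ) (i j k : Fin 5) (b : β) :
    Psi φ st e (i, j, k, b) = kz (Yc φ e b) st.1 st.2 i j k := rfl

lemma dl_fin (s j : Fin 5) : dl s j = if s = j then 1 else 0 := by
  simp [dl, Fin.ext_iff]

lemma Psi_rankone (φ : ℕ → γ → ℂ) (v : β → ℂ) (w : γ → ℂ) :
    finrank ℂ (Submodule.span ℂ (Set.range fun st => Psi φ st (fun p : β × γ => v p.1 * w p.2)))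
      ≤ 6 := by
  set X : Fin 5 → Fin 5 → (Fin 5 × Fin 5 × Fin 5 × β → ℂ) :=
    fun s t => Psi φ (s, t) (fun p : β × γ => v p.1 * w p.2) with hX
  set a : Fin 5 → ℂ := fun i => ∑ c, φ i c * w c with ha
  have hY : ∀ (i : Fin 5) b, Yc φ (fun p : β × γ => v p.1 * w p.2) b i = v b * a i := by
    intro i b
    simp only [Yc, ha, Finset.mul_sum]
    exact Finset.sum_congr rfl fun c _ => by ring
  have anti : ∀ s t, X s t = - X t s := by
    intro s t
    funext x
    simp only [hX, Psi, LinearMap.coe_mk, AddHom.coe_mk, Pi.neg_apply, kz]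
    ring
  have diag : ∀ s, X s s = 0 := by
    intro s
    funext x
    simp only [hX, Psi, LinearMap.coe_mk, AddHom.coe_mk, Pi.zero_apply, kz]
    ring
  have rel : ∀ t, ∑ s, a s • X s t = 0 := by
    intro t
    funext ⟨i, j, k, b⟩
    have hs : ∀ j : Fin 5, ∑ s, a s * dl s j = a j := by
      intro j
      simp [dl_fin]
    simp only [Finset.sum_apply, Pi.smul_apply, smul_eq_mul, hX, Psi_apply, kz, hY, Pi.zero_apply]
    have : ∀ s : Fin 5, a s * (v b * a i * (dl s j * dl t k - dl s k * dl t j) -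
          v b * a j * (dl s i * dl t k - dl s k * dl t i) +
        v b * a k * (dl s i * dl t j - dl s j * dl t i)) =
        (a s * dl s j) * (v b * a i * dl t k) - (a s * dl s k) * (v b * a i * dl t j)
        - (a s * dl s i) * (v b * a j * dl t k) + (a s * dl s k) * (v b * a j * dl t i)
        + (a s * dl s i) * (v b * a k * dl t j) - (a s * dl s j) * (v b * a k * dl t i) := by
      intro s; ring
    simp only [this, Finset.sum_add_distrib, Finset.sum_sub_distrib, ← Finset.sum_mul, hs]
    ring
  by_cases h0 : ∀ i, a i = 0
  · have : ∀ st, Psi φ st (fun p : β × γ => v p.1 * w p.2) = 0 := by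
      rintro ⟨s, t⟩
      funext ⟨i, j, k, b⟩
      simp only [Psi_apply, kz, hY, h0, Pi.zero_apply]
      ring
    have hb : Submodule.span ℂ (Set.range fun st =>
        Psi φ st (fun p : β × γ => v p.1 * w p.2)) = ⊥ := by
      rw [Submodule.span_eq_bot]
      rintro _ ⟨st, rfl⟩
      exact this st
    rw [hb, finrank_bot]
    omega
  · push Not at h0
    obtain ⟨i0, hi0⟩ := h0
    classical
    let G : Finset (Fin 5 × Fin 5) :=
      Finset.univ.filter fun st => st.1 < st.2 ∧ st.1 ≠ i0 ∧ st.2 ≠ i0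
    have hG : G.card ≤ 6 := by
      simp only [G]
      clear * -
      revert i0
      decide
    have hle : Submodule.span ℂ (Set.range fun st => Psi φ st (fun p : β × γ => v p.1 * w p.2)) ≤
        Submodule.span ℂ (↑(G.image (fun st => X st.1 st.2)) : Set (Fin 5 × Fin 5 × Fin 5 × β → ℂ)) := by
      set S := Submodule.span ℂ (↑(G.image (fun st => X st.1 st.2)) : Set (Fin 5 × Fin 5 × Fin 5 × β → ℂ)) with hS
      have h1 : ∀ s t, s ≠ i0 → t ≠ i0 → X s t ∈ S := by
        intro s t hs ht
        rcases lt_trichotomy s t with h | h | h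
        · apply Submodule.subset_span
          simp only [Finset.coe_image, Set.mem_image, Finset.mem_coe]
          exact ⟨(s, t), by simp [G, h, hs, ht], rfl⟩
        · subst h; rw [diag]; exact S.zero_mem
        · rw [anti]
          apply S.neg_mem
          apply Submodule.subset_span
          simp only [Finset.coe_image, Set.mem_image, Finset.mem_coe]
          exact ⟨(t, s), by simp [G, h, hs, ht], rfl⟩
      have h2 : ∀ t, t ≠ i0 → X i0 t ∈ S := by
        intro t ht
        have := rel t
        rw [← Finset.add_sum_erase _ _ (Finset.mem_univ i0)] at this
        have e : X i0 t = -((a i0)⁻¹ • ∑ s ∈ Finset.univ.erase i0, a s • X s t) := by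
          rw [← eq_neg_iff_add_eq_zero] at this
          rw [← smul_neg, ← this, smul_smul, inv_mul_cancel₀ hi0, one_smul]
        rw [e]
        apply S.neg_mem
        apply S.smul_mem
        apply S.sum_mem
        intro s hs
        exact S.smul_mem _ (h1 s t (Finset.ne_of_mem_erase hs) ht)
      rw [Submodule.span_le]
      rintro _ ⟨⟨s, t⟩, rfl⟩
      change X s t ∈ S
      by_cases hs : s = i0
      · by_cases ht : t = i0
        · rw [hs, ht, diag]; exact S.zero_mem
        · rw [hs]; exact h2 t ht
      · by_cases ht : t = i0
        · rw [anti, ht]; exact S.neg_mem (h2 s hs)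
        · exact h1 s t hs ht
    calc _ ≤ _ := Submodule.finrank_mono hle
      _ ≤ (G.image fun st => X st.1 st.2).card := finrank_span_finset_le_card _
      _ ≤ G.card := Finset.card_image_le
      _ ≤ 6 := hG

/-- the first Koszul map -/
def Psi1 [DecidableEq γ] (s : γ) : (β × γ → ℂ) →ₗ[ℂ] (γ × γ × β → ℂ) where
  toFun e x := e (x.2.2, x.1) * (if s = x.2.1 then 1 else 0)
    - e (x.2.2, x.2.1) * (if s = x.1 then 1 else 0)
  map_add' e e' := by
    funext x
    simp only [Pi.add_apply]
    ring
  map_smul' a e := by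
    funext x
    simp only [Pi.smul_apply, smul_eq_mul, RingHom.id_apply]
    ring

lemma Psi1_rankone [DecidableEq γ] (v : β → ℂ) (w : γ → ℂ) :
    finrank ℂ (Submodule.span ℂ (Set.range fun s => Psi1 s (fun p : β × γ => v p.1 * w p.2)))
      ≤ Fintype.card γ - 1 := by
  set X : γ → (γ × γ × β → ℂ) := fun s => Psi1 s (fun p : β × γ => v p.1 * w p.2) with hX
  have rel : ∑ s, w s • X s = 0 := by
    funext ⟨i, j, b⟩
    simp only [Finset.sum_apply, Pi.smul_apply, smul_eq_mul, hX, Psi1, LinearMap.coe_mk,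
      AddHom.coe_mk, Pi.zero_apply, mul_sub, Finset.sum_sub_distrib]
    simp
    ring
  by_cases h0 : ∀ i, w i = 0
  · have : ∀ s, Psi1 s (fun p : β × γ => v p.1 * w p.2) = 0 := by
      intro s
      funext ⟨i, j, b⟩
      simp [Psi1, h0]
    have hb : Submodule.span ℂ (Set.range X) = ⊥ := by
      rw [Submodule.span_eq_bot]
      rintro _ ⟨st, rfl⟩
      exact this st
    rw [hb, finrank_bot]
    omega
  · push Not at h0
    obtain ⟨i0, hi0⟩ := h0
    classical
    have hle : Submodule.span ℂ (Set.range X) ≤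
        Submodule.span ℂ (↑((Finset.univ.erase i0).image X) : Set (γ × γ × β → ℂ)) := by
      set S := Submodule.span ℂ (↑((Finset.univ.erase i0).image X) : Set (γ × γ × β → ℂ)) with hS
      have h1 : ∀ s, s ≠ i0 → X s ∈ S := by
        intro s hs
        apply Submodule.subset_span
        simp only [Finset.coe_image, Set.mem_image, Finset.mem_coe]
        exact ⟨s, by simp [hs], rfl⟩
      rw [Submodule.span_le]
      rintro _ ⟨s, rfl⟩
      by_cases hs : s = i0
      · subst hs
        rw [← Finset.add_sum_erase _ _ (Finset.mem_univ s)] at rel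
        have e : X s = -((w s)⁻¹ • ∑ s ∈ Finset.univ.erase s, w s • X s) := by
          rw [← eq_neg_iff_add_eq_zero] at rel
          rw [← smul_neg, ← rel, smul_smul, inv_mul_cancel₀ hi0, one_smul]
        rw [SetLike.mem_coe, e]
        apply S.neg_mem
        apply S.smul_mem
        apply S.sum_mem
        intro t ht
        exact S.smul_mem _ (h1 t (Finset.ne_of_mem_erase ht))
      · exact h1 s hs
    calc _ ≤ _ := Submodule.finrank_mono hle
      _ ≤ ((Finset.univ.erase i0).image X).card := finrank_span_finset_le_card _
      _ ≤ (Finset.univ.erase i0).card := Finset.card_image_le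
      _ = _ := by rw [Finset.card_erase_of_mem (Finset.mem_univ _), Finset.card_univ]

end CWK
end

noncomputable section
namespace CWK
open Topology Filter

section
variable {α β γ α' β' γ' : Type}

def BL (T : α → β → γ → ℂ) (r : ℕ) : Prop := T ∈ closure {S : α → β → γ → ℂ | rankLE S r}

lemma rankLE_of_sum {κ : Type} [Fintype κ] {r : ℕ} (T : α → β → γ → ℂ)
    (hc : Fintype.card κ = r)
    (u : κ → α → ℂ) (v : κ → β → ℂ) (w : κ → γ → ℂ)
    (h : ∀ i j k, T i j k = ∑ l, u l i * v l j * w l k) : rankLE T r := by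
  let e : Fin r ≃ κ := (Fintype.equivFinOfCardEq hc).symm
  refine ⟨fun l => u (e l), fun l => v (e l), fun l => w (e l), ?_⟩
  funext i j k
  rw [h]
  exact (Equiv.sum_comp e (fun l => u l i * v l j * w l k)).symm

lemma rankLE_succ {T : α → β → γ → ℂ} {r : ℕ} (h : rankLE T r) : rankLE T (r + 1) := by
  obtain ⟨u, v, w, rfl⟩ := h
  refine ⟨Fin.cons 0 u, Fin.cons 0 v, Fin.cons 0 w, ?_⟩
  funext i j k
  simp [Fin.sum_univ_succ]

lemma rankLE_mono {T : α → β → γ → ℂ} {r s : ℕ} (hrs : r ≤ s) (h : rankLE T r) : rankLE T s := by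
  induction hrs with
  | refl => exact h
  | step _ ih => exact rankLE_succ ih

lemma BL_mono {T : α → β → γ → ℂ} {r s : ℕ} (hrs : r ≤ s) (h : BL T r) : BL T s :=
  closure_mono (fun _ hS => rankLE_mono hrs hS) h

lemma BL_map {T : α → β → γ → ℂ} {r s : ℕ} (F : (α → β → γ → ℂ) → (α' → β' → γ' → ℂ))
    (hF : Continuous F) (h : ∀ S, rankLE S r → rankLE (F S) s) (hT : BL T r) : BL (F T) s :=
  map_mem_closure hF hT h

lemma BL_pull {T : α → β → γ → ℂ} {r : ℕ} (f : α' → α) (g : β' → β) (h : γ' → γ)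
    (a : α' → ℂ) (b : β' → ℂ) (c : γ' → ℂ) (hT : BL T r) :
    BL (fun i j k => a i * b j * c k * T (f i) (g j) (h k)) r := by
  refine BL_map (fun S i j k => a i * b j * c k * S (f i) (g j) (h k)) ?_ ?_ hT
  · fun_prop
  · rintro _ ⟨u, v, w, rfl⟩
    refine ⟨fun l i => a i * u l (f i), fun l j => b j * v l (g j), fun l k => c k * w l (h k), ?_⟩
    funext i j k
    simp only [Finset.mul_sum]
    exact Finset.sum_congr rfl fun l _ => by ring

lemma BL_tr [Fintype α] [Fintype β] [Fintype γ] {T : α → β → γ → ℂ} {r : ℕ}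
    (A : α' → α → ℂ) (B : β' → β → ℂ) (C : γ' → γ → ℂ) (hT : BL T r) :
    BL (fun i j k => ∑ i', ∑ j', ∑ k', A i i' * B j j' * C k k' * T i' j' k') r := by
  refine BL_map (fun S i j k => ∑ i', ∑ j', ∑ k', A i i' * B j j' * C k k' * S i' j' k') ?_ ?_ hT
  · fun_prop
  · rintro _ ⟨u, v, w, rfl⟩
    refine ⟨fun l i => ∑ i', A i i' * u l i', fun l j => ∑ j', B j j' * v l j',
      fun l k => ∑ k', C k k' * w l k', ?_⟩
    funext i j k
    have e : ∀ l, (∑ i', A i i' * u l i') * (∑ j', B j j' * v l j') * (∑ k', C k k' * w l k')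
        = ∑ i', ∑ j', ∑ k', A i i' * B j j' * C k k' * (u l i' * v l j' * w l k') := by
      intro l
      rw [Finset.sum_mul_sum, Finset.sum_mul]
      refine Finset.sum_congr rfl fun i' _ => ?_
      rw [Finset.sum_mul]
      refine Finset.sum_congr rfl fun j' _ => ?_
      rw [Finset.mul_sum]
      refine Finset.sum_congr rfl fun k' _ => ?_
      ring
    rw [Finset.sum_congr rfl fun l _ => e l]
    simp only [Finset.mul_sum]
    symm
    rw [Finset.sum_comm]
    refine Finset.sum_congr rfl fun i' _ => ?_
    rw [Finset.sum_comm]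
    refine Finset.sum_congr rfl fun j' _ => ?_
    rw [Finset.sum_comm]

lemma BL_swap {T : α → β → γ → ℂ} {r : ℕ} (hT : BL T r) : BL (fun j i k => T i j k) r := by
  refine BL_map (fun S j i k => S i j k) ?_ ?_ hT
  · fun_prop
  · rintro _ ⟨u, v, w, rfl⟩
    refine ⟨v, u, w, ?_⟩
    funext j i k
    exact Finset.sum_congr rfl fun l _ => by ring

lemma rankLE_kron {S : α → β → γ → ℂ} {S' : α' → β' → γ' → ℂ} {r r' : ℕ}
    (h : rankLE S r) (h' : rankLE S' r') : rankLE (kron S S') (r * r') := by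
  obtain ⟨u, v, w, rfl⟩ := h
  obtain ⟨u', v', w', rfl⟩ := h'
  refine rankLE_of_sum (κ := Fin r × Fin r') _ (by simp) (fun l i => u l.1 i.1 * u' l.2 i.2)
    (fun l i => v l.1 i.1 * v' l.2 i.2) (fun l i => w l.1 i.1 * w' l.2 i.2) ?_
  intro i j k
  simp only [kron, Finset.sum_mul_sum, Fintype.sum_prod_type]
  exact Finset.sum_congr rfl fun l _ => Finset.sum_congr rfl fun l' _ => by ring

lemma BL_kron {S : α → β → γ → ℂ} {S' : α' → β' → γ' → ℂ} {r r' : ℕ}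
    (h : BL S r) (h' : BL S' r') : BL (kron S S') (r * r') := by
  refine map_mem_closure₂ (f := fun S S' => kron S S') ?_ h h' ?_
  · unfold kron; fun_prop
  · intro a ha b hb
    exact rankLE_kron ha hb

end

/-- indicator functions -/
def eps_cw (q : ℕ) (ε : ℂ) : Fin (q + 1) → Fin (q + 1) → Fin (q + 1) → ℂ := fun i j k =>
  let a : Fin (q+1) → ℂ := fun i => if i = 0 then 1 else 0
  let b : Fin (q+1) → ℂ := fun i => if i = 0 then 0 else 1
  cw q i j k + ε * ((if i = j ∧ j = k ∧ i ≠ 0 then 1 else 0)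
    - (a i * b j * b k + b i * a j * b k + b i * b j * a k)) - ε ^ 3 * (b i * b j * b k)

lemma rankLE_eps (q : ℕ) (ε : ℂ) (hε : ε ≠ 0) : rankLE (eps_cw q ε) (q + 2) := by
  set a : Fin (q+1) → ℂ := fun i => if i = 0 then 1 else 0 with ha
  set b : Fin (q+1) → ℂ := fun i => if i = 0 then 0 else 1 with hb
  let V : Fin q ⊕ Fin 2 → Fin (q+1) → ℂ := Sum.elim (fun m i => a i + ε * (if i = m.succ then 1 else 0))
    (fun t i => if t = 0 then a i + ε ^ 2 * b i else a i)
  let C : Fin q ⊕ Fin 2 → ℂ := Sum.elim (fun _ => (ε ^ 2)⁻¹)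
    (fun t => if t = 0 then -(ε ^ 3)⁻¹ else (ε ^ 3)⁻¹ - q * (ε^2)⁻¹)
  refine rankLE_of_sum (κ := Fin q ⊕ Fin 2) _ (by simp) (fun l i => C l * V l i) V V ?_
  intro i j k
  simp only [Fintype.sum_sum_type, V, C, Sum.elim_inl, Sum.elim_inr, Fin.sum_univ_two, if_true]
  simp only [Fin.isValue, one_ne_zero, if_false]
  have s1 : ∀ i : Fin (q+1), ∑ m : Fin q, (if i = m.succ then (1:ℂ) else 0) = b i := by
    intro i
    refine Fin.cases ?_ (fun i => ?_) i
    · simp [hb, Fin.succ_ne_zero, eq_comm]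
    · simp [hb, Fin.succ_ne_zero]
  have e : ∀ m : Fin q, (ε ^ 2)⁻¹ * (a i + ε * (if i = m.succ then 1 else 0)) *
      (a j + ε * (if j = m.succ then 1 else 0)) * (a k + ε * (if k = m.succ then 1 else 0)) =
      (ε ^ 2)⁻¹ * (a i * a j * a k) + (ε ^ 2)⁻¹ * ε * (a i * a j * (if k = m.succ then 1 else 0)
       + a i * a k * (if j = m.succ then 1 else 0) + a j * a k * (if i = m.succ then 1 else 0))
      + (ε ^ 2)⁻¹ * ε ^ 2 * (a i * (if j = m.succ ∧ k = m.succ then 1 else 0)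
       + a j * (if i = m.succ ∧ k = m.succ then 1 else 0) + a k * (if i = m.succ ∧ j = m.succ then 1 else 0))
      + (ε ^ 2)⁻¹ * ε ^ 3 * (if i = m.succ ∧ j = m.succ ∧ k = m.succ then 1 else 0) := by
    intro m
    by_cases h1 : i = m.succ <;> by_cases h2 : j = m.succ <;> by_cases h3 : k = m.succ <;>
      simp only [h1, h2, h3, if_true, if_false, and_self, and_true, true_and, and_false, false_and] <;> ring
  have s2 : ∀ i j : Fin (q+1), ∑ m : Fin q, (if i = m.succ ∧ j = m.succ then (1:ℂ) else 0) =
      if i = j ∧ i ≠ 0 then 1 else 0 := by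
    intro i j
    by_cases h : i = j
    · subst h; simp only [and_self, s1, hb]; simp
    · have : ∀ m : Fin q, ¬ (i = m.succ ∧ j = m.succ) := fun m h' => h (h'.1.trans h'.2.symm)
      simp [h, this]
  have s3 : ∑ m : Fin q, (if i = m.succ ∧ j = m.succ ∧ k = m.succ then (1:ℂ) else 0) =
      if i = j ∧ j = k ∧ i ≠ 0 then 1 else 0 := by
    by_cases h : i = j
    · subst h
      have := s2 i k
      simp only [← and_assoc, and_self, true_and] at this ⊢
      rw [this]
    · have : ∀ m : Fin q, ¬ (i = m.succ ∧ j = m.succ ∧ k = m.succ) :=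
        fun m h' => h (h'.1.trans h'.2.1.symm)
      simp [h, this]
  simp only [e, Finset.sum_add_distrib, ← Finset.mul_sum, s1, s2, s3, Finset.sum_const,
    Finset.card_univ, Fintype.card_fin, nsmul_eq_mul]
  have hcw : cw q i j k = a i * (if j = k ∧ j ≠ 0 then 1 else 0) + a j * (if i = k ∧ i ≠ 0 then 1 else 0)
      + a k * (if i = j ∧ i ≠ 0 then 1 else 0) := by
    have hv : ∀ x : Fin (q+1), x.val = 0 ↔ x = 0 := fun x => Fin.val_eq_zero_iff
    simp only [cw, ha, hv, ne_eq]
    rcases eq_or_ne i 0 with h1 | h1 <;> rcases eq_or_ne j 0 with h2 | h2 <;> rcases eq_or_ne k 0 with h3 | h3 <;>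
      first | simp [h1, h2, h3] | (simp [h1, h2, h3, Ne.symm h1]; done) | (simp [h1, h2, h3, Ne.symm h2]; done) | (simp [h1, h2, h3, Ne.symm h3]; done) | simp [h1, h2, h3, Ne.symm h1, Ne.symm h2, Ne.symm h3]
  simp only [eps_cw]
  rw [hcw]
  field_simp
  ring

lemma BL_cw (q : ℕ) : BL (cw q) (q + 2) := by
  have h : Tendsto (fun ε : ℂ => eps_cw q ε) (𝓝[≠] 0) (𝓝 (cw q)) := by
    have hc : Continuous (fun ε : ℂ => eps_cw q ε) := by
      unfold eps_cw; fun_prop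
    have := (hc.tendsto 0).mono_left (nhdsWithin_le_nhds (s := {0}ᶜ))
    have e : eps_cw q 0 = cw q := by
      funext i j k
      simp [eps_cw]
    rwa [e] at this
  refine mem_closure_of_tendsto h ?_
  filter_upwards [self_mem_nhdsWithin] with ε hε
  exact rankLE_eps q ε hε

end CWK
end

noncomputable section
namespace CWK
open Topology Filter

lemma proj_closed {X Y : Type*} [TopologicalSpace X] [TopologicalSpace Y] (K : Set X)
    (hK : IsCompact K) (Z : Set (X × Y)) (hZ : IsClosed Z) :
    IsClosed {y | ∃ x ∈ K, (x, y) ∈ Z} := by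
  have : CompactSpace K := isCompact_iff_compactSpace.1 hK
  have h1 : IsClosed {p : K × Y | ((p.1 : X), p.2) ∈ Z} :=
    hZ.preimage (by fun_prop)
  have h2 := isClosedMap_snd_of_compactSpace _ h1
  convert h2 using 1
  ext y
  simp

section
variable {α β γ : Type} [Fintype α] [DecidableEq α]

lemma subst_rank [Nonempty α] {T : α → β → γ → ℂ} {r : ℕ} (h : rankLE T (r + 1)) :
    ∃ i0 : α, ∃ a ∈ Metric.closedBall (0 : α → ℂ) 1, a i0 = 1 ∧
      rankLE (fun i j k => T i j k - a i * T i0 j k) r := by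
  obtain ⟨u, v, w, rfl⟩ := h
  by_cases h0 : u 0 = 0
  · obtain ⟨i0⟩ := ‹Nonempty α›
    refine ⟨i0, fun i => if i = i0 then 1 else 0, ?_, by simp, ?_⟩
    · rw [mem_closedBall_zero_iff, pi_norm_le_iff_of_nonneg zero_le_one]
      intro i
      split_ifs <;> simp
    · refine ⟨fun l i => u l.succ i - (if i = i0 then 1 else 0) * u l.succ i0,
        fun l => v l.succ, fun l => w l.succ, ?_⟩
      funext i j k
      simp only [Fin.sum_univ_succ, h0, Pi.zero_apply, zero_mul, zero_add, Finset.mul_sum,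
        ← Finset.sum_sub_distrib]
      exact Finset.sum_congr rfl fun l _ => by ring
  · obtain ⟨i0, -, hi0⟩ := Finset.exists_max_image Finset.univ (fun i => ‖u 0 i‖)
      Finset.univ_nonempty
    have hne : u 0 i0 ≠ 0 := by
      intro hz
      apply h0
      funext i
      have := hi0 i (Finset.mem_univ i)
      rw [hz, norm_zero] at this
      simpa using this
    refine ⟨i0, fun i => u 0 i / u 0 i0, ?_, div_self hne, ?_⟩
    · rw [mem_closedBall_zero_iff, pi_norm_le_iff_of_nonneg zero_le_one]
      intro i
      rw [norm_div]
      exact div_le_one_of_le₀ (hi0 i (Finset.mem_univ i)) (norm_nonneg _)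
    · refine ⟨fun l i => u l.succ i - u 0 i / u 0 i0 * u l.succ i0,
        fun l => v l.succ, fun l => w l.succ, ?_⟩
      funext i j k
      have e : u 0 i / u 0 i0 * (u 0 i0 * v 0 j * w 0 k) = u 0 i * v 0 j * w 0 k := by
        field_simp
      simp only [Fin.sum_univ_succ, mul_add, e, Finset.mul_sum]
      rw [add_sub_add_left_eq_sub, ← Finset.sum_sub_distrib]
      exact Finset.sum_congr rfl fun l _ => by ring

lemma subst_BL [Nonempty α] {T : α → β → γ → ℂ} {r : ℕ} (h : BL T (r + 1)) :
    ∃ i0 : α, ∃ a : α → ℂ, a i0 = 1 ∧ BL (fun i j k => T i j k - a i * T i0 j k) r := by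
  have hcl : IsClosed (⋃ i0 : α, {T : α → β → γ → ℂ | ∃ a ∈ Metric.closedBall (0 : α → ℂ) 1,
      (a, T) ∈ {p : (α → ℂ) × (α → β → γ → ℂ) | p.1 i0 = 1 ∧
        BL (fun i j k => p.2 i j k - p.1 i * p.2 i0 j k) r}}) := by
    apply isClosed_iUnion_of_finite
    intro i0
    apply proj_closed _ (isCompact_closedBall _ _)
    apply IsClosed.inter
    · exact isClosed_eq (by fun_prop) (by fun_prop)
    · have hc : Continuous (fun p : (α → ℂ) × (α → β → γ → ℂ) => fun i j k =>
          p.2 i j k - p.1 i * p.2 i0 j k) := by fun_prop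
      exact isClosed_closure.preimage hc
  have := closure_minimal (s := {S : α → β → γ → ℂ | rankLE S (r + 1)}) ?_ hcl h
  · rw [Set.mem_iUnion] at this
    obtain ⟨i0, a, -, h1, h2⟩ := this
    exact ⟨i0, a, h1, h2⟩
  · intro S hS
    obtain ⟨i0, a, ha, h1, h2⟩ := subst_rank hS
    rw [Set.mem_iUnion]
    exact ⟨i0, a, ha, h1, subset_closure h2⟩

lemma BL_lim {T : α → β → γ → ℂ} {r : ℕ} (U : ℂ → α → β → γ → ℂ) (hU : Continuous U)
    (h : ∀ ε ≠ 0, BL (U ε) r) (h0 : U 0 = T) : BL T r := by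
  have h1 : Tendsto U (𝓝[≠] 0) (𝓝 T) := by
    rw [← h0]
    exact (hU.tendsto 0).mono_left nhdsWithin_le_nhds
  refine isClosed_closure.mem_of_tendsto h1 ?_
  filter_upwards [self_mem_nhdsWithin] with ε hε
  exact h ε hε

lemma torus [Nonempty α] {T : α → β → γ → ℂ} {r : ℕ} (h : BL T (r + 1))
    (χ : α → ℕ) (χB : β → ℕ) (χC : γ → ℕ) (K : ℕ)
    (hs : ∀ i j k, T i j k ≠ 0 → χ i + χB j + χC k = K) (hinj : Function.Injective χ) :
    ∃ i1, BL (fun i j k => if i = i1 then 0 else T i j k) r := by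
  obtain ⟨i0, a, ha, hB⟩ := subst_BL h
  obtain ⟨i1, hi1, hmax⟩ := Finset.exists_max_image (Finset.univ.filter fun i => a i ≠ 0) χ
    ⟨i0, by simp [ha]⟩
  simp only [Finset.mem_filter, Finset.mem_univ, true_and] at hi1 hmax
  refine ⟨i1, ?_⟩
  set b : α → ℂ := fun i => a i / a i1 with hb
  have hB1 : BL (fun i j k => T i j k - b i * T i1 j k) r := by
    have := BL_map (fun S i j k => S i j k - b i * S i1 j k) (by fun_prop) (s := r) ?_ hB
    · convert this using 4 with i j k
      simp only [hb]
      field_simp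
      ring
    · rintro _ ⟨u, v, w, rfl⟩
      refine ⟨fun l i => u l i - b i * u l i1, v, w, ?_⟩
      funext i j k
      simp only [Finset.mul_sum, ← Finset.sum_sub_distrib]
      exact Finset.sum_congr rfl fun l _ => by ring
  refine BL_lim (fun ε i j k => T i j k - b i * ε ^ (χ i1 - χ i) * T i1 j k) (by fun_prop) ?_ ?_
  · intro ε hε
    have := BL_pull (id : α → α) (id : β → β) (id : γ → γ) (fun i => ε⁻¹ ^ χ i)
      (fun j => ε⁻¹ ^ χB j) (fun k => ε⁻¹ ^ χC k * ε ^ K) hB1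
    convert this using 4 with i j k
    simp only [id]
    have e1 : ∀ i j k, T i j k ≠ 0 → ε⁻¹ ^ χB j * (ε⁻¹ ^ χC k * ε ^ K) = ε ^ χ i := by
      intro i j k hT
      rw [← hs i j k hT]
      simp only [inv_pow]
      field_simp
      ring
    have e2 : ε⁻¹ ^ χ i * ε⁻¹ ^ χB j * (ε⁻¹ ^ χC k * ε ^ K) * T i j k = T i j k := by
      by_cases hT : T i j k = 0
      · simp [hT]
      · rw [mul_assoc (ε⁻¹ ^ χ i), e1 i j k hT, inv_pow, inv_mul_cancel₀ (pow_ne_zero _ hε), one_mul]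
    rw [mul_sub, e2]
    congr 1
    by_cases hT : T i1 j k = 0
    · simp [hT]
    · rw [mul_assoc (ε⁻¹ ^ χ i), e1 i1 j k hT]
      by_cases hai : a i = 0
      · simp [hb, hai]
      · have := hmax i hai
        rw [pow_sub₀ _ hε this, inv_pow]
        ring
  · funext i j k
    by_cases hi : i = i1
    · subst hi
      simp [hb, hi1]
    · rw [if_neg hi]
      by_cases hai : a i = 0
      · simp [hb, hai]
      · have h1 := hmax i hai
        have h2 : χ i ≠ χ i1 := fun h => hi (hinj h)
        rw [zero_pow (by omega)]
        ring

end
end CWK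
end

noncomputable section
namespace CWK
open Topology Filter Module

lemma closed_rank {ι κ : Type} [Finite κ] [Finite ι] (n : ℕ) :
    IsClosed {g : ι → (κ → ℂ) | finrank ℂ (Submodule.span ℂ (Set.range g)) ≤ n} := by
  have h : {g : ι → (κ → ℂ) | finrank ℂ (Submodule.span ℂ (Set.range g)) ≤ n} =
      ⋂ e : Fin (n + 1) → ι, {g : ι → (κ → ℂ) | ¬ LinearIndependent ℂ (fun l => g (e l))} := by
    ext g
    simp only [Set.mem_ofPred_eq, Set.mem_iInter]
    constructor
    · intro h e he
      have h1 := finrank_span_eq_card he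
      have h2 : Submodule.span ℂ (Set.range fun l => g (e l)) ≤ Submodule.span ℂ (Set.range g) := by
        apply Submodule.span_mono
        rintro _ ⟨l, rfl⟩
        exact ⟨_, rfl⟩
      have h3 := Submodule.finrank_mono h2
      rw [h1, Fintype.card_fin] at h3
      omega
    · intro h
      by_contra hn
      push Not at hn
      obtain ⟨ι', a, ha, hs, hl⟩ := exists_linearIndependent' ℂ g
      have : Finite ι' := Finite.of_injective a ha
      have := Fintype.ofFinite ι'
      have h1 := finrank_span_eq_card hl
      rw [hs] at h1
      obtain ⟨e⟩ := Function.Embedding.nonempty_of_card_le (α := Fin (n+1)) (β := ι')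
        (by rw [Fintype.card_fin]; omega)
      exact h (fun l => a (e l)) (hl.comp e e.injective)
  rw [h]
  refine isClosed_iInter fun e => ?_
  have := Fintype.ofFinite κ
  have : IsOpen {f : Fin (n+1) → (κ → ℂ) | LinearIndependent ℂ f} := isOpen_setOf_linearIndependent
  have hc : Continuous (fun (g : ι → (κ → ℂ)) (l : Fin (n+1)) => g (e l)) := by fun_prop
  exact (this.preimage hc).isClosed_compl

lemma finrank_fam_le {ι σ κ : Type} [Fintype ι] [Finite σ] [Finite κ] (F : ι → σ → (κ → ℂ)) (k : ℕ)
    (h : ∀ l, finrank ℂ (Submodule.span ℂ (Set.range (F l))) ≤ k) :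
    finrank ℂ (Submodule.span ℂ (Set.range fun p : ι × σ => F p.1 p.2)) ≤ Fintype.card ι * k := by
  classical
  have key : ∀ s : Finset ι, finrank ℂ (s.sup fun l => Submodule.span ℂ (Set.range (F l)) :
      Submodule ℂ (κ → ℂ)) ≤ s.card * k := by
    intro s
    induction s using Finset.induction_on with
    | empty => simp
    | insert a s ha ih =>
      rw [Finset.sup_insert, Finset.card_insert_of_notMem ha]
      have := Submodule.finrank_add_le_finrank_add_finrank (Submodule.span ℂ (Set.range (F a)))
        (s.sup fun l => Submodule.span ℂ (Set.range (F l)))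
      have h1 := h a
      calc _ ≤ _ := this
        _ ≤ k + s.card * k := by omega
        _ = _ := by ring
  refine le_trans (Submodule.finrank_mono ?_) (key Finset.univ)
  rw [Submodule.span_le]
  rintro _ ⟨⟨l, s⟩, rfl⟩
  exact Finset.le_sup (f := fun l => Submodule.span ℂ (Set.range (F l))) (Finset.mem_univ l)
    (Submodule.subset_span ⟨s, rfl⟩)

section
variable {π : Type} [Fintype π]

def ON {r : ℕ} (f : Fin r → π → ℂ) : Prop :=
  ∀ l m, ∑ p, (starRingEnd ℂ) (f l p) * f m p = if l = m then 1 else 0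

lemma ON.li {r : ℕ} {f : Fin r → π → ℂ} (h : ON f) : LinearIndependent ℂ f := by
  rw [Fintype.linearIndependent_iff]
  intro g hg l
  have : ∑ p, (starRingEnd ℂ) (f l p) * (∑ m, g m • f m) p = g l := by
    simp only [Finset.sum_apply, Pi.smul_apply, smul_eq_mul, Finset.mul_sum]
    rw [Finset.sum_comm]
    have : ∀ m, ∑ p, (starRingEnd ℂ) (f l p) * (g m * f m p) = g m * if l = m then 1 else 0 := by
      intro m
      rw [← h l m, Finset.mul_sum]
      exact Finset.sum_congr rfl fun p _ => by ring
    simp [this]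
  rw [hg] at this
  simpa using this.symm

lemma ON.mem {r : ℕ} {f : Fin r → π → ℂ} (h : ON f) (x : π → ℂ) :
    x ∈ Submodule.span ℂ (Set.range f) ↔
      x = ∑ l, (∑ p, (starRingEnd ℂ) (f l p) * x p) • f l := by
  constructor
  · intro hx
    rw [Submodule.mem_span_range_iff_exists_fun] at hx
    obtain ⟨c, rfl⟩ := hx
    refine Finset.sum_congr rfl fun l _ => ?_
    congr 1
    simp only [Finset.sum_apply, Pi.smul_apply, smul_eq_mul, Finset.mul_sum]
    rw [Finset.sum_comm]
    have : ∀ m, ∑ p, (starRingEnd ℂ) (f l p) * (c m * f m p) = c m * if l = m then 1 else 0 := by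
      intro m
      rw [← h l m, Finset.mul_sum]
      exact Finset.sum_congr rfl fun p _ => by ring
    simp [this]
  · intro hx
    rw [hx]
    exact Submodule.sum_mem _ fun l _ => Submodule.smul_mem _ _ (Submodule.subset_span ⟨l, rfl⟩)

lemma exists_ON {r : ℕ} (E : Submodule ℂ (π → ℂ)) (hE : finrank ℂ E = r) :
    ∃ f : Fin r → π → ℂ, ON f ∧ Submodule.span ℂ (Set.range f) = E := by
  let L := (WithLp.linearEquiv 2 ℂ (π → ℂ)).symm
  let E' : Submodule ℂ (EuclideanSpace ℂ π) := E.map L.toLinearMap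
  have hE' : finrank ℂ E' = r := by rw [← hE]; exact LinearEquiv.finrank_map_eq L E
  let b := (stdOrthonormalBasis ℂ E').reindex (finCongr hE')
  have hb := b.orthonormal
  rw [orthonormal_iff_ite] at hb
  refine ⟨fun l => L.symm (b l : EuclideanSpace ℂ π), ?_, ?_⟩
  · intro l m
    rw [← hb l m, Submodule.coe_inner]
    simp only [PiLp.inner_apply, RCLike.inner_apply]
    exact Finset.sum_congr rfl fun p _ => mul_comm _ _
  · have h1 : Submodule.span ℂ (Set.range fun l => (b l : EuclideanSpace ℂ π)) = E' := by
      have : (Set.range fun l => (b l : EuclideanSpace ℂ π)) = E'.subtype '' (Set.range b.toBasis) := by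
        rw [← Set.range_comp]; congr 1
      rw [this, Submodule.span_image, b.toBasis.span_eq, Submodule.map_top, Submodule.range_subtype]
    have h2 : (Set.range fun l => L.symm (b l : EuclideanSpace ℂ π)) =
        L.symm.toLinearMap '' (Set.range fun l => (b l : EuclideanSpace ℂ π)) := by
      rw [← Set.range_comp]; rfl
    rw [h2, Submodule.span_image, h1]
    ext x
    simp [E']

lemma compact_ON (r : ℕ) : IsCompact {f : Fin r → π → ℂ | ON f} := by
  apply Metric.isCompact_of_isClosed_isBounded
  · have : {f : Fin r → π → ℂ | ON f} = ⋂ l, ⋂ m, {f : Fin r → π → ℂ |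
        ∑ p, (starRingEnd ℂ) (f l p) * f m p = if l = m then 1 else 0} := by
      ext f; simp [ON]
    rw [this]
    refine isClosed_iInter fun l => isClosed_iInter fun m => isClosed_eq ?_ continuous_const
    have hc : ∀ p, Continuous fun f : Fin r → π → ℂ => (starRingEnd ℂ) (f l p) := fun p =>
      Complex.continuous_conj.comp (by fun_prop)
    exact continuous_finsetSum _ fun p _ => (hc p).mul (by fun_prop)
  · refine (Metric.isBounded_closedBall (x := (0 : Fin r → π → ℂ)) (r := 1)).subset ?_
    intro f hf
    rw [mem_closedBall_zero_iff, pi_norm_le_iff_of_nonneg zero_le_one]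
    intro l
    rw [pi_norm_le_iff_of_nonneg zero_le_one]
    intro p
    have h1 := hf l l
    rw [if_pos rfl] at h1
    have h2 : ∀ p, (starRingEnd ℂ) (f l p) * f l p = ((‖f l p‖ ^ 2 : ℝ) : ℂ) := by
      intro p
      rw [mul_comm, Complex.mul_conj, Complex.normSq_eq_norm_sq]
    simp only [h2, ← Complex.ofReal_sum] at h1
    have h3 : ∑ p, ‖f l p‖ ^ 2 = 1 := by exact_mod_cast h1
    have h4 : ‖f l p‖ ^ 2 ≤ 1 := by
      rw [← h3]
      exact Finset.single_le_sum (f := fun p => ‖f l p‖ ^ 2) (fun p _ => by positivity) (Finset.mem_univ p)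
    nlinarith [norm_nonneg (f l p)]

end

section
variable {α β γ : Type} [Fintype α] [Fintype β] [Fintype γ]

lemma exists_rankone {T : α → β → γ → ℂ} {r : ℕ} (h : rankLE T r)
    (hr : r ≤ Fintype.card β * Fintype.card γ) :
    ∃ g : Fin r → (β × γ → ℂ), LinearIndependent ℂ g ∧
      (∀ l, ∃ (v : β → ℂ) (w : γ → ℂ), g l = fun p => v p.1 * w p.2) ∧
      ∀ i, (fun p : β × γ => T i p.1 p.2) ∈ Submodule.span ℂ (Set.range g) := by
  classical
  obtain ⟨u, v, w, rfl⟩ := h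
  let x : Fin r → (β × γ → ℂ) := fun l p => v l p.1 * w l p.2
  obtain ⟨b, hb1, hb2, hb3⟩ := exists_linearIndependent ℂ (Set.range x)
  have hb4 : LinearIndepOn ℂ id b := hb3
  let t : Set (β × γ → ℂ) := {y | ∃ (v : β → ℂ) (w : γ → ℂ), y = fun p => v p.1 * w p.2}
  have hbt : b ⊆ t := by
    intro y hy
    obtain ⟨l, rfl⟩ := hb1 hy
    exact ⟨v l, w l, rfl⟩
  have ht : (⊤ : Submodule ℂ (β × γ → ℂ)) ≤ Submodule.span ℂ t := by
    rw [← (Pi.basisFun ℂ (β × γ)).span_eq]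
    apply Submodule.span_mono
    rintro _ ⟨⟨b, c⟩, rfl⟩
    refine ⟨Pi.single b 1, Pi.single c 1, ?_⟩
    funext p
    simp only [Pi.basisFun_apply, Pi.single_apply, Prod.ext_iff]
    by_cases h1 : p.1 = b <;> by_cases h2 : p.2 = c <;> simp [h1, h2]
  let ext := hb4.extend hbt
  have he1 : ext ⊆ t := hb4.extend_subset hbt
  have he2 : b ⊆ ext := hb4.subset_extend hbt
  have he3 : LinearIndepOn ℂ id ext := hb4.linearIndepOn_extend hbt
  have he4 : Submodule.span ℂ ext = ⊤ := by
    rw [hb4.span_extend_eq_span hbt]; exact top_le_iff.1 ht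
  have hfin : ext.Finite := LinearIndependent.setFinite (R := ℂ) he3
  have := hfin.fintype
  have hcard : ext.ncard = Fintype.card β * Fintype.card γ := by
    have h1 := finrank_span_eq_card (R := ℂ) (b := (fun y : ext => (y : β × γ → ℂ))) he3
    rw [Subtype.range_coe, he4, finrank_top, finrank_fintype_fun_eq_card, Fintype.card_prod] at h1
    rw [← Nat.card_coe_set_eq, Nat.card_eq_fintype_card, ← h1]
  have hbr : b.ncard ≤ r := by
    calc b.ncard ≤ (Set.range x).ncard := Set.ncard_le_ncard hb1 (Set.finite_range x)
      _ ≤ r := by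
        rw [← Set.image_univ]
        refine (Set.ncard_image_le Set.finite_univ).trans ?_
        simp [Set.ncard_univ]
  obtain ⟨s, hs1, hs2, hs3⟩ := Set.exists_subsuperset_card_eq he2 hbr (by rw [hcard]; exact hr)
  have := (hfin.subset hs2).fintype
  have hc : Fintype.card s = r := by
    rw [← Nat.card_eq_fintype_card, Nat.card_coe_set_eq, hs3]
  let e : Fin r ≃ s := (Fintype.equivFinOfCardEq hc).symm
  have hli : LinearIndependent ℂ (fun y : s => (y : β × γ → ℂ)) := LinearIndepOn.mono he3 hs2
  refine ⟨fun l => (e l : β × γ → ℂ), hli.comp e e.injective, ?_, ?_⟩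
  · intro l
    exact he1 (hs2 (e l).2)
  · intro i
    have hrange : Set.range (fun l => (e l : β × γ → ℂ)) = s := by
      ext y
      constructor
      · rintro ⟨l, rfl⟩; exact (e l).2
      · intro hy; exact ⟨e.symm ⟨y, hy⟩, by simp⟩
    rw [hrange]
    have : (fun p : β × γ => ∑ l, u l i * v l p.1 * w l p.2) = ∑ l, u l i • x l := by
      funext p
      simp [x, mul_assoc]
    rw [this]
    refine Submodule.sum_mem _ fun l _ => Submodule.smul_mem _ _ ?_
    have h1 : x l ∈ Submodule.span ℂ b := by
      rw [hb2]; exact Submodule.subset_span ⟨l, rfl⟩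
    exact Submodule.span_mono hs1 h1

def goodFam {r : ℕ} (f : Fin r → (β × γ → ℂ)) : Prop :=
  ∀ (σ κ : Type) [Fintype σ] [Fintype κ] (Ψ : σ → ((β × γ → ℂ) →ₗ[ℂ] (κ → ℂ))) (k : ℕ),
      (∀ (v : β → ℂ) (w : γ → ℂ),
        finrank ℂ (Submodule.span ℂ (Set.range fun s => Ψ s (fun p => v p.1 * w p.2))) ≤ k) →
      finrank ℂ (Submodule.span ℂ (Set.range fun p : Fin r × σ => Ψ p.2 (f p.1))) ≤ r * k

lemma closed_good (r : ℕ) : IsClosed {f : Fin r → (β × γ → ℂ) | goodFam f} := by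
  have : {f : Fin r → (β × γ → ℂ) | goodFam f} = ⋂ (σ : Type) (κ : Type) (_ : Fintype σ)
      (_ : Fintype κ) (Ψ : σ → ((β × γ → ℂ) →ₗ[ℂ] (κ → ℂ))) (k : ℕ)
      (_ : ∀ (v : β → ℂ) (w : γ → ℂ),
        finrank ℂ (Submodule.span ℂ (Set.range fun s => Ψ s (fun p => v p.1 * w p.2))) ≤ k),
      {f : Fin r → (β × γ → ℂ) |
        finrank ℂ (Submodule.span ℂ (Set.range fun p : Fin r × σ => Ψ p.2 (f p.1))) ≤ r * k} := by
    ext f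
    simp only [Set.mem_iInter, Set.mem_ofPred_eq]
    exact Iff.rfl
  rw [this]
  refine isClosed_iInter fun σ => isClosed_iInter fun κ => isClosed_iInter fun _ =>
    isClosed_iInter fun _ => isClosed_iInter fun Ψ => isClosed_iInter fun k =>
    isClosed_iInter fun _ => ?_
  have hc : Continuous (fun (f : Fin r → (β × γ → ℂ)) (p : Fin r × σ) => Ψ p.2 (f p.1)) := by
    refine continuous_pi fun p => ?_
    exact (LinearMap.continuous_of_finiteDimensional (Ψ p.2)).comp (continuous_apply p.1)
  exact (closed_rank (r * k)).preimage hc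

theorem E_lemma {T : α → β → γ → ℂ} {r : ℕ} (h : BL T r)
    (hr : r ≤ Fintype.card β * Fintype.card γ) :
    ∃ f : Fin r → (β × γ → ℂ), LinearIndependent ℂ f ∧
      (∀ i, (fun p : β × γ => T i p.1 p.2) ∈ Submodule.span ℂ (Set.range f)) ∧ goodFam f := by
  have hcl : IsClosed {T : α → β → γ → ℂ | ∃ f ∈ {f : Fin r → (β × γ → ℂ) | ON f},
      (f, T) ∈ {q : (Fin r → (β × γ → ℂ)) × (α → β → γ → ℂ) | goodFam q.1 ∧
        ∀ i, (fun p : β × γ => q.2 i p.1 p.2) =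
          ∑ l, (∑ p, (starRingEnd ℂ) (q.1 l p) * q.2 i p.1 p.2) • q.1 l}} := by
    apply proj_closed _ (compact_ON r)
    apply IsClosed.inter
    · exact (closed_good r).preimage continuous_fst
    · have : {q : (Fin r → (β × γ → ℂ)) × (α → β → γ → ℂ) |
        ∀ i, (fun p : β × γ => q.2 i p.1 p.2) =
          ∑ l, (∑ p, (starRingEnd ℂ) (q.1 l p) * q.2 i p.1 p.2) • q.1 l} = ⋂ i,
          {q : (Fin r → (β × γ → ℂ)) × (α → β → γ → ℂ) | (fun p : β × γ => q.2 i p.1 p.2) =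
          ∑ l, (∑ p, (starRingEnd ℂ) (q.1 l p) * q.2 i p.1 p.2) • q.1 l} := by
        ext q; simp
      change IsClosed {q : (Fin r → (β × γ → ℂ)) × (α → β → γ → ℂ) | _}
      rw [this]
      refine isClosed_iInter fun i => isClosed_eq (by fun_prop) ?_
      refine continuous_finsetSum _ fun l _ => ?_
      have hc2 : Continuous (fun q : (Fin r → (β × γ → ℂ)) × (α → β → γ → ℂ) => q.1 l) := by
        fun_prop
      have hc3 : Continuous (fun q : (Fin r → (β × γ → ℂ)) × (α → β → γ → ℂ) =>
          ∑ p : β × γ, (starRingEnd ℂ) (q.1 l p) * q.2 i p.1 p.2) := by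
        refine continuous_finsetSum _ fun p _ => ?_
        have hc1 : Continuous (fun q : (Fin r → (β × γ → ℂ)) × (α → β → γ → ℂ) => q.1 l p) := by
          fun_prop
        exact (Complex.continuous_conj.comp hc1).mul (by fun_prop)
      exact hc3.smul hc2
  have := closure_minimal (s := {S : α → β → γ → ℂ | rankLE S r}) ?_ hcl h
  · obtain ⟨f, hf, hg, hT⟩ := this
    exact ⟨f, ON.li hf, fun i => (ON.mem hf _).2 (hT i), hg⟩
  · intro S hS
    obtain ⟨g, hg1, hg2, hg3⟩ := exists_rankone hS hr
    obtain ⟨f, hf1, hf2⟩ := exists_ON (Submodule.span ℂ (Set.range g))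
      (by rw [finrank_span_eq_card hg1, Fintype.card_fin])
    refine ⟨f, hf1, ?_, fun i => (ON.mem hf1 _).1 (hf2 ▸ hg3 i)⟩
    intro σ κ _ _ Ψ k hk
    have h1 := finrank_fam_le (fun (l : Fin r) (s : σ) => Ψ s (g l)) k (by
      intro l
      obtain ⟨v, w, hvw⟩ := hg2 l
      rw [hvw]
      exact hk v w)
    rw [Fintype.card_fin] at h1
    refine le_trans (Submodule.finrank_mono ?_) h1
    rw [Submodule.span_le]
    rintro _ ⟨⟨l, s⟩, rfl⟩
    have h2 : f l ∈ Submodule.span ℂ (Set.range g) := hf2 ▸ Submodule.subset_span ⟨l, rfl⟩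
    have h3 := Submodule.mem_map_of_mem (f := Ψ s) h2
    rw [← Submodule.span_image] at h3
    refine Submodule.span_mono ?_ h3
    rintro _ ⟨_, ⟨m, rfl⟩, rfl⟩
    exact ⟨(m, s), rfl⟩

end
end CWK
end

noncomputable section
namespace CWK
open Module

lemma W_le {α β γ σ κ : Type} [Fintype α] [Fintype β] [Fintype γ] [Fintype σ] [Fintype κ]
    {r k : ℕ} {f : Fin r → (β × γ → ℂ)} (hg : goodFam f)
    (Ψ : σ → ((β × γ → ℂ) →ₗ[ℂ] (κ → ℂ)))
    (hk : ∀ (v : β → ℂ) (w : γ → ℂ),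
        finrank ℂ (Submodule.span ℂ (Set.range fun s => Ψ s (fun p => v p.1 * w p.2))) ≤ k)
    (x : α → (β × γ → ℂ)) (hx : ∀ a, x a ∈ Submodule.span ℂ (Set.range f)) :
    Submodule.span ℂ (Set.range fun p : α × σ => Ψ p.2 (x p.1)) ≤
      Submodule.span ℂ (Set.range fun p : Fin r × σ => Ψ p.2 (f p.1)) ∧
    finrank ℂ (Submodule.span ℂ (Set.range fun p : α × σ => Ψ p.2 (x p.1))) ≤ r * k := by
  have : Submodule.span ℂ (Set.range fun p : α × σ => Ψ p.2 (x p.1)) ≤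
      Submodule.span ℂ (Set.range fun p : Fin r × σ => Ψ p.2 (f p.1)) := by
    rw [Submodule.span_le]
    rintro _ ⟨⟨l, s⟩, rfl⟩
    have h3 := Submodule.mem_map_of_mem (f := Ψ s) (hx l)
    rw [← Submodule.span_image] at h3
    refine Submodule.span_mono ?_ h3
    rintro _ ⟨_, ⟨m, rfl⟩, rfl⟩
    exact ⟨(m, s), rfl⟩
  exact ⟨this, (Submodule.finrank_mono this).trans (hg σ κ Ψ k hk)⟩

lemma block_sum {κ ι : Type} [Finite κ] [DecidableEq ι] (cl : κ → ι) (WB : ι → Submodule ℂ (κ → ℂ))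
    (hcl : ∀ B, ∀ v ∈ WB B, ∀ x, v x ≠ 0 → cl x = B) (J : Finset ι) :
    (∀ v ∈ (J.sup WB), ∀ x, v x ≠ 0 → cl x ∈ J) ∧
    finrank ℂ (J.sup WB : Submodule ℂ (κ → ℂ)) = ∑ B ∈ J, finrank ℂ (WB B) := by
  induction J using Finset.induction_on with
  | empty =>
    constructor
    · intro v hv x hx
      simp only [Finset.sup_empty, Submodule.mem_bot] at hv
      exact absurd (by rw [hv]; rfl) hx
    · simp
  | insert B J hB ih =>
    rw [Finset.sup_insert]
    constructor
    · intro v hv x hx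
      obtain ⟨y, hy, z, hz, rfl⟩ := Submodule.mem_sup.1 hv
      rw [Finset.mem_insert]
      by_cases h : y x = 0
      · right
        apply ih.1 z hz x
        simpa [h] using hx
      · left
        exact hcl B y hy x h
    · have hd : WB B ⊓ J.sup WB = ⊥ := by
        rw [eq_bot_iff]
        rintro v ⟨h1, h2⟩
        rw [Submodule.mem_bot]
        funext x
        by_contra hx
        have e1 := hcl B v h1 x hx
        have e2 := ih.1 v h2 x hx
        rw [e1] at e2
        exact hB e2
      have := Submodule.finrank_sup_add_finrank_inf_eq (WB B) (J.sup WB)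
      rw [hd, finrank_bot, ih.2] at this
      rw [Finset.sum_insert hB]
      omega

def prS (p : ℕ) : ℕ := Nat.mod (Nat.shiftRight 215303127040 (Nat.mul 4 p)) 16
def prT (p : ℕ) : ℕ := Nat.mod (Nat.shiftRight 292933485345 (Nat.mul 4 p)) 16
def trI (p : ℕ) : ℕ := Nat.mod (Nat.shiftRight 142019133440 (Nat.mul 4 p)) 16
def trJ (p : ℕ) : ℕ := Nat.mod (Nat.shiftRight 219617042705 (Nat.mul 4 p)) 16
def trK (p : ℕ) : ℕ := Nat.mod (Nat.shiftRight 293186319410 (Nat.mul 4 p)) 16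

lemma pr_lt : ∀ p < 10, prS p < prT p ∧ prT p < 5 := by decide
lemma tr_lt : ∀ p < 10, trI p < trJ p ∧ trJ p < trK p ∧ trK p < 5 := by decide

/-- third index for cw; 100 if none -/
def th (i b : ℕ) : ℕ :=
  bif Nat.beq i 0 then (bif Nat.beq b 0 then 100 else b) else
  bif Nat.beq b 0 then i else bif Nat.beq i b then 0 else 100

def th' (n i b : ℕ) : ℕ := bif Nat.beq n 1 then 0 else th i b

/-- the projection to `ℂ^5` as a bit table -/
def phiZ (P : ℕ) (i c1 c2 : ℕ) : ℤ :=
  bif Nat.ble 4 c1 || Nat.ble 4 c2 then 0 else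
  bif Nat.testBit P (Nat.add (Nat.mul 5 (Nat.add (Nat.mul 4 c1) c2)) i) then 1 else 0

lemma phiZ_zero (P i c1 c2 : ℕ) (h : 4 ≤ c1 ∨ 4 ≤ c2) : phiZ P i c1 c2 = 0 := by
  have : (Nat.ble 4 c1 || Nat.ble 4 c2) = true := by
    simpa using h
  simp [phiZ, this]

def blkRow (P n1 n2 x1 x2 p : ℕ) : ℕ → ℤ := fun c =>
  kzI (fun i => phiZ P i (th' n1 x1 (c % (n1 * n2) / n2)) (th' n2 x2 (c % n2))) (prS p) (prT p)
    (trI (c / (n1 * n2))) (trJ (c / (n1 * n2))) (trK (c / (n1 * n2)))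

def blkRows (P n1 n2 : ℕ) : List (ℕ → ℤ) :=
  (List.range (n1 * n2)).flatMap fun a => (List.range 10).map fun p => blkRow P n1 n2 (a / n2) (a % n2) p

def PQ : ℕ := 482690170536116423456137

/-- the rank certificate for a block -/
def Blk (R k n1 n2 : ℕ) : Prop :=
  Nat.ble R (rk k ((blkRows PQ n1 n2).map (mask (10 * (n1 * n2))))) = true

set_option maxRecDepth 100000 in
theorem blk44 : Blk 145 160 4 4 := by
  unfold Blk
  decide +kernel
set_option maxRecDepth 100000 in
theorem blk41 : Blk 30 40 4 1 := by
  unfold Blk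
  decide +kernel
set_option maxRecDepth 100000 in
theorem blk14 : Blk 30 40 1 4 := by
  unfold Blk
  decide +kernel
set_option maxRecDepth 100000 in
theorem blk11 : Blk 6 10 1 1 := by
  unfold Blk
  decide +kernel

lemma cw_sum (q : ℕ) (hq : 3 ≤ q) (a b : Fin (q+1)) (F : ℕ → ℂ) (hF : ∀ n, 4 ≤ n → F n = 0) :
    ∑ c : Fin (q+1), F c * cw q a b c = F (th a b) := by
  have h100 := hF 100 (by norm_num)
  have hv : ∀ x : Fin (q+1), x.val = 0 ↔ x = 0 := fun x => Fin.val_eq_zero_iff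
  simp only [th, beq_dec, cw, hv]
  by_cases ha : a = 0
  · by_cases hb : b = 0
    · simp [ha, hb, h100]
    · simp [ha, hb, h100]
  · by_cases hb : b = 0
    · simp [ha, hb, h100]
    · by_cases hab : a = b
      · subst hab; simp [ha]
      · have : ¬ (a.val = b.val) := fun h => hab (Fin.ext h)
        simp [ha, hb, hab, this, h100]

abbrev slice {α β γ : Type} (T : α → β → γ → ℂ) (a : α) : β × γ → ℂ := fun p => T a p.1 p.2

def phiC (P q : ℕ) : ℕ → Fin (q+1) × Fin (q+1) → ℂ := fun i c => (phiZ P i c.1 c.2 : ℂ)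

lemma Yc_slice (P q : ℕ) (hq : 3 ≤ q) (a b : Fin (q+1) × Fin (q+1)) (i : ℕ) :
    Yc (phiC P q) (slice (kron (cw q) (cw q)) a) b i =
      (phiZ P i (th a.1 b.1) (th a.2 b.2) : ℂ) := by
  simp only [Yc, slice, kron, phiC, Fintype.sum_prod_type]
  have h1 : ∀ c1 : Fin (q+1), ∑ c2 : Fin (q+1), ((phiZ P i c1 c2 : ℤ) : ℂ) *
      (cw q a.1 b.1 c1 * cw q a.2 b.2 c2) = (phiZ P i c1 (th a.2 b.2) : ℂ) * cw q a.1 b.1 c1 := by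
    intro c1
    have := cw_sum q hq a.2 b.2 (fun n => (phiZ P i c1 n : ℂ)) (fun n hn => by
      simp [phiZ_zero _ _ _ _ (Or.inr hn)])
    rw [← this, Finset.sum_mul]
    exact Finset.sum_congr rfl fun c2 _ => by ring
  simp only [h1]
  exact cw_sum q hq a.1 b.1 (fun n => (phiZ P i n (th a.2 b.2) : ℂ)) (fun n hn => by
      simp [phiZ_zero _ _ _ _ (Or.inl hn)])

def cls (x : ℕ) : ℕ := if x < 4 then 0 else x

lemma th_cls (a b : ℕ) (h : cls a ≠ cls b) : 4 ≤ th a b := by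
  simp only [th, beq_dec]
  simp only [cls] at h
  by_cases ha : a = 0 <;> by_cases hb : b = 0 <;> by_cases hab : a = b <;>
    simp [ha, hb, hab] at h ⊢ <;> omega

/-- block of rows -/
def WBl (q : ℕ) (B : ℕ × ℕ) : Submodule ℂ (Fin 5 × Fin 5 × Fin 5 × (Fin (q+1) × Fin (q+1)) → ℂ) :=
  Submodule.span ℂ {v | ∃ (a : Fin (q+1) × Fin (q+1)) (st : Fin 5 × Fin 5), (cls a.1, cls a.2) = B ∧
    v = Psi (phiC PQ q) st (slice (kron (cw q) (cw q)) a)}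

lemma WBl_cls (q : ℕ) (hq : 3 ≤ q) (B : ℕ × ℕ) : ∀ v ∈ WBl q B, ∀ x, v x ≠ 0 →
    (cls x.2.2.2.1, cls x.2.2.2.2) = B := by
  intro v hv x hx
  by_contra hne
  apply hx
  clear hx
  induction hv using Submodule.span_induction with
  | mem v hv =>
    obtain ⟨a, st, rfl, rfl⟩ := hv
    have hz : ∀ i, Yc (phiC PQ q) (slice (kron (cw q) (cw q)) a) x.2.2.2 i = 0 := by
      intro i
      rw [Yc_slice _ _ hq, phiZ_zero]
      · simp
      · by_cases h1 : cls a.1 = cls x.2.2.2.1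
        · right
          apply th_cls
          intro h2
          exact hne (by rw [h1, h2])
        · left
          exact th_cls _ _ h1
    obtain ⟨i, j, k, b⟩ := x
    rw [Psi_apply]
    simp only [kz, hz]
    ring
  | zero => rfl
  | add x y _ _ hx hy =>
    rw [Pi.add_apply, hx, hy, add_zero]
  | smul a x _ hx => rw [Pi.smul_apply, hx, smul_zero]

lemma th_blk (m n x x' : ℕ) (h : (m = 0 ∧ n = 4) ∨ (4 ≤ m ∧ n = 1)) (hx : x < n) (hx' : x' < n) :
    th (m + x) (m + x') = th' n x x' := by
  rcases h with ⟨rfl, rfl⟩ | ⟨h, rfl⟩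
  · simp [th', beq_dec]
  · have e1 : x = 0 := by omega
    have e2 : x' = 0 := by omega
    subst e1 e2
    have : m ≠ 0 := by omega
    simp [th', th, beq_dec, this]

lemma cls_blk (m n x : ℕ) (h : (m = 0 ∧ n = 4) ∨ (4 ≤ m ∧ n = 1)) (hx : x < n) :
    cls (m + x) = m := by
  simp only [cls]
  split_ifs <;> omega

lemma blk_rank (q : ℕ) (hq : 3 ≤ q) (m1 n1 m2 n2 R k : ℕ)
    (h1 : (m1 = 0 ∧ n1 = 4) ∨ (4 ≤ m1 ∧ n1 = 1)) (h2 : (m2 = 0 ∧ n2 = 4) ∨ (4 ≤ m2 ∧ n2 = 1))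
    (hm1 : m1 ≤ q) (hm2 : m2 ≤ q)
    (hR : Blk R k n1 n2) :
    R ≤ finrank ℂ (WBl q (m1, m2)) := by
  have hn1 : 0 < n1 := by omega
  have hn2 : 0 < n2 := by omega
  have hn : 0 < n1 * n2 := Nat.mul_pos hn1 hn2
  refine cert _ (10 * (n1 * n2)) (fun c => (Fin.ofNat 5 (trI (c / (n1 * n2))),
    Fin.ofNat 5 (trJ (c / (n1 * n2))), Fin.ofNat 5 (trK (c / (n1 * n2))),
    (Fin.ofNat (q+1) (m1 + c % (n1 * n2) / n2), Fin.ofNat (q+1) (m2 + c % n2)))) _ ?_ k R hR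
  intro r hr
  simp only [blkRows, List.mem_flatMap, List.mem_map, List.mem_range] at hr
  obtain ⟨a, ha, p, hp, rfl⟩ := hr
  have hx1 : a / n2 < n1 := by rw [Nat.div_lt_iff_lt_mul hn2]; exact ha
  have hx2 : a % n2 < n2 := Nat.mod_lt _ hn2
  have hbd1 : ∀ x, x < n1 → m1 + x < q + 1 := by omega
  have hbd2 : ∀ x, x < n2 → m2 + x < q + 1 := by omega
  refine ⟨Psi (phiC PQ q) (Fin.ofNat 5 (prS p), Fin.ofNat 5 (prT p)) (slice (kron (cw q) (cw q))
    (⟨m1 + a / n2, hbd1 _ hx1⟩, ⟨m2 + a % n2, hbd2 _ hx2⟩)), ?_, ?_⟩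
  · apply Submodule.subset_span
    exact ⟨_, _, by simp [cls_blk _ _ _ h1 hx1, cls_blk _ _ _ h2 hx2], rfl⟩
  · intro c hc
    have ht : c / (n1 * n2) < 10 := by rw [Nat.div_lt_iff_lt_mul hn]; exact hc
    have hy1 : c % (n1 * n2) / n2 < n1 := by
      rw [Nat.div_lt_iff_lt_mul hn2]; exact Nat.mod_lt _ hn
    have hy2 : c % n2 < n2 := Nat.mod_lt _ hn2
    obtain ⟨p1, p2⟩ := pr_lt p hp
    obtain ⟨t1, t2, t3⟩ := tr_lt _ ht
    have v1 : ∀ x, x < 5 → (Fin.ofNat 5 x).val = x := fun x hx => Nat.mod_eq_of_lt hx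
    have v2 : ∀ x, x < q + 1 → (Fin.ofNat (q+1) x).val = x := fun x hx => Nat.mod_eq_of_lt hx
    rw [Psi_apply, v1 _ (by omega), v1 _ (by omega), v1 _ (by omega), v1 _ (by omega),
      v1 _ (by omega), blkRow]
    have hY : ∀ i, Yc (phiC PQ q) (slice (kron (cw q) (cw q))
        (⟨m1 + a / n2, hbd1 _ hx1⟩, ⟨m2 + a % n2, hbd2 _ hx2⟩))
        (Fin.ofNat (q+1) (m1 + c % (n1 * n2) / n2), Fin.ofNat (q+1) (m2 + c % n2)) i =
        ((phiZ PQ i (th' n1 (a / n2) (c % (n1 * n2) / n2)) (th' n2 (a % n2) (c % n2)) : ℤ) : ℂ) := by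
      intro i
      rw [Yc_slice _ _ hq]
      simp only [v2 _ (hbd1 _ hy1), v2 _ (hbd2 _ hy2)]
      rw [th_blk _ _ _ _ h1 hx1 hy1, th_blk _ _ _ _ h2 hx2 hy2]
    exact kz_eq _ _ _ _ _ _ _ p1 t1 t2 (hY _) (hY _) (hY _)

theorem lower3 (q : ℕ) (hq : 3 ≤ q) : ¬ BL (kron (cw q) (cw q)) ((q + 2) ^ 2 - 1) := by
  intro hBL
  have hle : (q + 2) ^ 2 - 1 ≤ Fintype.card (Fin (q+1) × Fin (q+1)) * Fintype.card (Fin (q+1) × Fin (q+1)) := by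
    simp only [Fintype.card_prod, Fintype.card_fin]
    have : (q + 2) ^ 2 ≤ ((q+1)*(q+1)) * ((q+1)*(q+1)) := by
      have h1 : (q + 2) ^ 2 ≤ ((q+1)*(q+1)) ^ 2 := Nat.pow_le_pow_left (by nlinarith) 2
      rwa [pow_two ((q+1)*(q+1))] at h1
    omega
  obtain ⟨f, -, hf, hg⟩ := E_lemma hBL hle
  obtain ⟨-, hW⟩ := W_le hg (Psi (phiC PQ q)) (Psi_rankone (phiC PQ q))
    (fun a => slice (kron (cw q) (cw q)) a) hf
  let I : Finset ℕ := insert 0 (Finset.Icc 4 q)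
  have hbs := (block_sum (fun x : Fin 5 × Fin 5 × Fin 5 × (Fin (q+1) × Fin (q+1)) =>
    (cls x.2.2.2.1, cls x.2.2.2.2)) (WBl q) (WBl_cls q hq) (I ×ˢ I)).2
  have hsup : ((I ×ˢ I).sup (WBl q)) ≤ Submodule.span ℂ (Set.range fun p :
      (Fin (q+1) × Fin (q+1)) × (Fin 5 × Fin 5) => Psi (phiC PQ q) p.2 (slice (kron (cw q) (cw q)) p.1)) := by
    apply Finset.sup_le
    intro B _
    apply Submodule.span_mono
    rintro _ ⟨a, st, -, rfl⟩
    exact ⟨(a, st), rfl⟩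
  have hfin := Submodule.finrank_mono hsup
  let R : ℕ → ℕ → ℕ := fun m1 m2 => if m1 = 0 then (if m2 = 0 then 145 else 30) else
    (if m2 = 0 then 30 else 6)
  have hR : ∀ B ∈ I ×ˢ I, R B.1 B.2 ≤ finrank ℂ (WBl q B) := by
    rintro ⟨m1, m2⟩ hB
    simp only [I, Finset.mem_product, Finset.mem_insert, Finset.mem_Icc] at hB
    obtain ⟨h1, h2⟩ := hB
    by_cases e1 : m1 = 0
    · by_cases e2 : m2 = 0
      · subst e1 e2
        simp only [R, if_true]
        exact blk_rank q hq 0 4 0 4 145 160 (by simp) (by simp) (by omega) (by omega) blk44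
      · subst e1
        simp only [R, e2, if_true, if_false]
        exact blk_rank q hq 0 4 m2 1 30 40 (by simp) (by omega) (by omega) (by omega) blk41
    · by_cases e2 : m2 = 0
      · subst e2
        simp only [R, e1, if_true, if_false]
        exact blk_rank q hq m1 1 0 4 30 40 (by omega) (by simp) (by omega) (by omega) blk14
      · simp only [R, e1, e2, if_false]
        exact blk_rank q hq m1 1 m2 1 6 10 (by omega) (by omega) (by omega) (by omega) blk11
  have hsum := Finset.sum_le_sum hR
  rw [← hbs] at hsum
  have h0 : (0 : ℕ) ∉ Finset.Icc 4 q := by simp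
  have hI : ∀ g : ℕ → ℕ, ∀ d, (∀ m, m ≠ 0 → g m = d) → ∑ m ∈ I, g m = g 0 + (q - 3) * d := by
    intro g d hgd
    rw [Finset.sum_insert h0, Finset.sum_congr rfl (g := fun _ => d)]
    · rw [Finset.sum_const, Nat.card_Icc, smul_eq_mul]
      congr 2
    · intro m hm
      apply hgd
      rw [Finset.mem_Icc] at hm
      omega
  have hval : ∑ B ∈ I ×ˢ I, R B.1 B.2 = 145 + (q-3)*30 + (q-3) * (30 + (q-3) * 6) := by
    rw [Finset.sum_product]
    simp only
    rw [hI (fun m1 => ∑ m2 ∈ I, R m1 m2) (30 + (q-3)*6)]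
    · rw [hI (fun m2 => R 0 m2) 30]
      · simp [R]
      · intro m hm; simp [R, hm]
    · intro m1 hm1
      rw [hI (fun m2 => R m1 m2) 6]
      · simp [R, hm1]
      · intro m hm; simp [R, hm, hm1]
  rw [hval] at hsum
  obtain ⟨t, rfl⟩ := Nat.exists_eq_add_of_le hq
  have e3 : 3 + t - 3 = t := by omega
  rw [e3] at hsum
  have h6 : 145 + t * 30 + t * (30 + t * 6) ≤ ((3 + t + 2) ^ 2 - 1) * 6 :=
    hsum.trans (hfin.trans hW)
  have h7 : (3 + t + 2) ^ 2 = t * t + 10 * t + 25 := by ring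
  rw [h7] at h6
  have h8 : t * (30 + t * 6) = 30 * t + 6 * (t * t) := by ring
  rw [h8] at h6
  omega

end CWK
end

noncomputable section
namespace CWK
open Module

/-- sparse table of a `8 × 9` zero-one matrix with at most one `1` per row -/
def tab (TB a b : ℕ) : ℕ := Nat.mod (Nat.shiftRight TB (Nat.mul 4 (Nat.add (Nat.mul 8 a) b))) 16

def vec (TB a : ℕ) : Fin 8 × Fin 9 → ℂ := fun p => if tab TB a p.1 = p.2 then 1 else 0

def phi9 (P i c : ℕ) : ℤ :=
  bif Nat.ble 9 c then 0 else
  bif Nat.testBit P (Nat.add (Nat.mul 5 c) i) then 1 else 0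

def phC (P : ℕ) : ℕ → Fin 9 → ℂ := fun i c => (phi9 P i c : ℂ)

lemma Yc_vec (P TB a : ℕ) (b : Fin 8) (i : ℕ) :
    Yc (phC P) (vec TB a) b i = (phi9 P i (tab TB a b) : ℂ) := by
  simp only [Yc, vec, phC]
  by_cases h : tab TB a b < 9
  · rw [Finset.sum_eq_single (⟨tab TB a b, h⟩ : Fin 9)]
    · simp
    · intro c _ hc
      have : tab TB a b ≠ c := fun h' => hc (Fin.ext h'.symm)
      simp [this]
    · simp
  · rw [Finset.sum_eq_zero]
    · have : Nat.ble 9 (tab TB a b) = true := by simpa using h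
      simp [phi9, this]
    · intro c _
      have : tab TB a b ≠ c := by omega
      simp [this]

def pos (t : ℕ) (b : Fin 8) : Fin 5 × Fin 5 × Fin 5 × Fin 8 :=
  (Fin.ofNat 5 (trI t), Fin.ofNat 5 (trJ t), Fin.ofNat 5 (trK t), b)

def PsiP {β γ : Type} [Fintype β] [Fintype γ] (φ : ℕ → γ → ℂ) (p : Fin 10) :
    (β × γ → ℂ) →ₗ[ℂ] (Fin 5 × Fin 5 × Fin 5 × β → ℂ) :=
  Psi φ (Fin.ofNat 5 (prS p), Fin.ofNat 5 (prT p))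

lemma PsiP_rankone {β γ : Type} [Fintype β] [Fintype γ] (φ : ℕ → γ → ℂ) (v : β → ℂ) (w : γ → ℂ) :
    finrank ℂ (Submodule.span ℂ (Set.range fun s => PsiP φ s (fun p => v p.1 * w p.2))) ≤ 6 := by
  refine le_trans (Submodule.finrank_mono ?_) (Psi_rankone φ v w)
  apply Submodule.span_mono
  rintro _ ⟨s, rfl⟩
  exact ⟨_, rfl⟩

def kcell (P p t c : ℕ) : ℤ :=
  kzI (fun i => phi9 P i c) (prS p) (prT p) (trI t) (trJ t) (trK t)

lemma PsiP_cell (P : ℕ) (p : Fin 10) (t : ℕ) (ht : t < 10) (b : Fin 8) (e : Fin 8 × Fin 9 → ℂ) (c : ℕ)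
    (hY : ∀ i, Yc (phC P) e b i = (phi9 P i c : ℂ)) :
    PsiP (phC P) p e (pos t b) = (kcell P p t c : ℂ) := by
  obtain ⟨p1, p2⟩ := pr_lt p p.2
  obtain ⟨t1, t2, t3⟩ := tr_lt _ ht
  have v1 : ∀ x, x < 5 → (Fin.ofNat 5 x).val = x := fun x hx => Nat.mod_eq_of_lt hx
  rw [PsiP, pos, Psi_apply, v1 _ (by omega), v1 _ (by omega), v1 _ (by omega), v1 _ (by omega),
      v1 _ (by omega), kcell]
  exact kz_eq _ _ _ _ _ _ _ p1 t1 t2 (hY _) (hY _) (hY _)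

def rowK (P TB a p : ℕ) : ℕ → ℤ := fun c => kcell P p (Nat.div c 8) (tab TB a (Nat.mod c 8))

def rowsK (P TB n : ℕ) : List (ℕ → ℤ) :=
  (List.range n).flatMap fun a => (List.range 10).map fun p => rowK P TB a p

def KC (P TB R : ℕ) : Prop :=
  Nat.ble R (rk 100 ((rowsK P TB 9).map (mask 80))) = true

lemma K_rank (P TB R : ℕ) (h : KC P TB R) :
    R ≤ finrank ℂ (Submodule.span ℂ (Set.range fun x : Fin 9 × Fin 10 => PsiP (phC P) x.2 (vec TB x.1))) := by
  refine cert _ 80 (fun c => pos (c / 8) (Fin.ofNat 8 (c % 8))) _ ?_ 100 R h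
  intro r hr
  simp only [rowsK, List.mem_flatMap, List.mem_map, List.mem_range] at hr
  obtain ⟨a, ha, p, hp, rfl⟩ := hr
  refine ⟨PsiP (phC P) ⟨p, hp⟩ (vec TB a), Submodule.subset_span ⟨(⟨a, ha⟩, ⟨p, hp⟩), rfl⟩, ?_⟩
  intro c hc
  have h8 : (Fin.ofNat 8 (c % 8)).val = c % 8 := Nat.mod_eq_of_lt (Nat.mod_lt _ (by norm_num))
  exact PsiP_cell P ⟨p, hp⟩ (c / 8) (by omega) _ _ (tab TB a (c % 8)) (fun i => by
    rw [Yc_vec, h8])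

def isum : ℕ → (ℕ → ℤ) → ℤ
  | 0, _ => 0
  | n + 1, f => Int.add (isum n f) (f n)

lemma isum_eq (n : ℕ) (f : ℕ → ℤ) : ((isum n f : ℤ) : ℂ) = ∑ i : Fin n, ((f i : ℤ) : ℂ) := by
  induction n with
  | zero => simp [isum]
  | succ n ih =>
    rw [Fin.sum_univ_castSucc]
    have : isum (n+1) f = isum n f + f n := rfl
    rw [this, Int.cast_add, ih]
    simp

/-- multiply by the base four digit, `2` standing for `-1` -/
def mulD (d : ℕ) (k : ℤ) : ℤ :=
  bif Nat.beq d 0 then 0 else bif Nat.beq d 1 then k else Int.neg k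

def mdig (M x : ℕ) : ℕ := Nat.mod (Nat.shiftRight M (Nat.mul 2 x)) 4

def cD (d : ℕ) : ℂ := if d = 0 then 0 else if d = 1 then 1 else -1

lemma mulD_eq (d : ℕ) (k : ℤ) : ((mulD d k : ℤ) : ℂ) = cD d * k := by
  have hneg : ∀ x : ℤ, Int.neg x = -x := fun x => rfl
  simp only [mulD, cD, beq_dec]
  by_cases h0 : d = 0
  · simp [h0]
  · by_cases h1 : d = 1
    · simp [h1]
    · simp [h0, h1, hneg]

def lam (M : ℕ) : (Fin 5 × Fin 5 × Fin 5 × Fin 8 → ℂ) →ₗ[ℂ] ℂ :=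
  ∑ t : Fin 10, ∑ b : Fin 8, cD (mdig M (Nat.add (Nat.mul 8 t) b)) • LinearMap.proj (pos t b)

lemma lam_apply (M : ℕ) (v) : lam M v =
    ∑ t : Fin 10, ∑ b : Fin 8, cD (mdig M (Nat.add (Nat.mul 8 t) b)) * v (pos t b) := by
  simp [lam, LinearMap.sum_apply]

def dotI (P M TB a p : ℕ) : ℤ :=
  isum 10 fun t => isum 8 fun b =>
    mulD (mdig M (Nat.add (Nat.mul 8 t) b)) (kcell P p t (tab TB a b))

lemma lam_vec (P M TB a : ℕ) (p : Fin 10) :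
    lam M (PsiP (phC P) p (vec TB a)) = (dotI P M TB a p : ℂ) := by
  rw [lam_apply, dotI, isum_eq]
  apply Finset.sum_congr rfl
  intro t _
  rw [isum_eq]
  apply Finset.sum_congr rfl
  intro b _
  rw [mulD_eq, PsiP_cell P p t t.2 b _ _ (fun i => Yc_vec P TB a b i)]

def frI (P M p b c : ℕ) : ℤ :=
  isum 10 fun t => mulD (mdig M (Nat.add (Nat.mul 8 t) b)) (kcell P p t c)

lemma lam_single (P M : ℕ) (p : Fin 10) (b : Fin 8) (c : Fin 9) :
    lam M (PsiP (phC P) p (Pi.single (b, c) 1)) = (frI P M p b c : ℂ) := by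
  rw [lam_apply, frI, isum_eq]
  apply Finset.sum_congr rfl
  intro t _
  rw [Finset.sum_eq_single b]
  · rw [mulD_eq, PsiP_cell P p t t.2 b _ c]
    intro i
    simp only [Yc, phC]
    rw [Finset.sum_eq_single c]
    · simp
    · intro c' _ hc
      have : ((b, c') : Fin 8 × Fin 9) ≠ (b, c) := by simpa using hc
      simp [Pi.single_eq_of_ne this]
    · simp
  · intro b' _ hb
    have : ∀ i, Yc (phC P) (Pi.single (b, c) 1) b' i = 0 := by
      intro i
      simp only [Yc]
      apply Finset.sum_eq_zero
      intro c' _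
      have : ((b', c') : Fin 8 × Fin 9) ≠ (b, c) := by
        intro h
        exact hb (congrArg Prod.fst h)
      rw [Pi.single_eq_of_ne this, mul_zero]
    rw [PsiP, pos, Psi_apply]
    simp only [kz, this]
    ring
  · simp

def frV (P M : ℕ) (p : Fin 10) : Fin 8 × Fin 9 → ℂ := fun x => (frI P M p x.1 x.2 : ℂ)

lemma lam_frV (P M : ℕ) (p : Fin 10) (e : Fin 8 × Fin 9 → ℂ) :
    lam M (PsiP (phC P) p e) = ∑ x, e x * frV P M p x := by
  have := LinearMap.pi_apply_eq_sum_univ ((lam M).comp (PsiP (phC P) p)) e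
  rw [LinearMap.comp_apply] at this
  rw [this]
  apply Finset.sum_congr rfl
  rintro ⟨b, c⟩ _
  rw [smul_eq_mul, frV, ← lam_single, LinearMap.comp_apply]
  congr 4
  funext y
  simp [Pi.single_apply, eq_comm]

lemma pair_le {κ : Type} [Fintype κ] [DecidableEq κ] (U D : Submodule ℂ (κ → ℂ))
    (h : ∀ u ∈ U, ∀ F ∈ D, ∑ x, u x * F x = 0) :
    finrank ℂ U + finrank ℂ D ≤ Fintype.card κ := by
  have h1 := Subspace.finrank_add_finrank_dualAnnihilator_eq U
  rw [Module.finrank_fintype_fun_eq_card] at h1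
  rw [← h1]
  apply Nat.add_le_add_left
  rw [← LinearEquiv.finrank_map_eq (dotProductEquiv ℂ κ) D]
  apply Submodule.finrank_mono
  rintro _ ⟨F, hF, rfl⟩
  rw [Submodule.mem_dualAnnihilator]
  intro u hu
  have := h u hu F hF
  simp only [LinearEquiv.coe_coe, dotProductEquiv_apply_apply, dotProduct]
  rw [← this]
  exact Finset.sum_congr rfl fun x _ => mul_comm _ _

/-- the annihilation check -/
def NuC (P M TB n : ℕ) : Prop :=
  ((List.range n).all fun a => (List.range 10).all fun p => dotI P M TB a p == 0) = true

lemma NuC_spec {P M TB n : ℕ} (h : NuC P M TB n) (a : ℕ) (ha : a < n) (p : Fin 10) :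
    lam M (PsiP (phC P) p (vec TB a)) = 0 := by
  rw [lam_vec]
  unfold NuC at h
  rw [List.all_eq_true] at h
  have h1 := h a (List.mem_range.2 ha)
  rw [List.all_eq_true] at h1
  have h2 := h1 p (List.mem_range.2 p.2)
  rw [beq_iff_eq] at h2
  rw [h2, Int.cast_zero]

lemma killed {P M TB n : ℕ} {f : Fin 13 → (Fin 8 × Fin 9 → ℂ)} (hg : goodFam f)
    (hv : ∀ a : Fin 9, vec TB a ∈ Submodule.span ℂ (Set.range f))
    (hK : KC P TB 78) (hn : 9 ≤ n) (hN : NuC P M TB n) (p : Fin 10)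
    (e : Fin 8 × Fin 9 → ℂ) (he : e ∈ Submodule.span ℂ (Set.range f)) :
    lam M (PsiP (phC P) p e) = 0 := by
  obtain ⟨hle, -⟩ := W_le hg (PsiP (phC P)) (PsiP_rankone (phC P)) (fun a : Fin 9 => vec TB a) hv
  have hK' := K_rank P TB 78 hK
  have h78 := hg (Fin 10) _ (PsiP (phC P)) 6 (PsiP_rankone (phC P))
  have heq := Submodule.eq_of_le_of_finrank_le hle (h78.trans (by simpa using hK'))
  have hker : Submodule.span ℂ (Set.range fun x : Fin 9 × Fin 10 => PsiP (phC P) x.2 (vec TB x.1)) ≤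
      LinearMap.ker (lam M) := by
    rw [Submodule.span_le]
    rintro _ ⟨⟨a, s⟩, rfl⟩
    exact NuC_spec hN a (by omega) s
  rw [heq] at hker
  have h3 := Submodule.mem_map_of_mem (f := PsiP (phC P) p) he
  rw [← Submodule.span_image] at h3
  refine hker (Submodule.span_mono ?_ h3)
  rintro _ ⟨_, ⟨m, rfl⟩, rfl⟩
  exact ⟨(m, p), rfl⟩

def rowF (P M p : ℕ) : ℕ → ℤ := fun y => frI P M p (Nat.div y 9) (Nat.mod y 9)

def rowsF (L : List (ℕ × ℕ)) : List (ℕ → ℤ) :=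
  L.flatMap fun x => (List.range 10).map fun p => rowF x.1 x.2 p

def FC (L : List (ℕ × ℕ)) (R : ℕ) : Prop :=
  Nat.ble R (rk 100 ((rowsF L).map (mask 72))) = true

def DF (L : List (ℕ × ℕ)) : Submodule ℂ (Fin 8 × Fin 9 → ℂ) :=
  Submodule.span ℂ {v | ∃ x ∈ L, ∃ p : Fin 10, v = frV x.1 x.2 p}

lemma F_rank (L : List (ℕ × ℕ)) (R : ℕ) (h : FC L R) : R ≤ finrank ℂ (DF L) := by
  refine cert _ 72 (fun y => (Fin.ofNat 8 (y / 9), Fin.ofNat 9 (y % 9))) _ ?_ 100 R h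
  intro r hr
  simp only [rowsF, List.mem_flatMap, List.mem_map, List.mem_range] at hr
  obtain ⟨x, hx, p, hp, rfl⟩ := hr
  refine ⟨frV x.1 x.2 ⟨p, hp⟩, Submodule.subset_span ⟨x, hx, _, rfl⟩, ?_⟩
  intro c hc
  have h8 : (Fin.ofNat 8 (c / 9)).val = c / 9 := Nat.mod_eq_of_lt (by omega)
  have h9 : (Fin.ofNat 9 (c % 9)).val = c % 9 := Nat.mod_eq_of_lt (by omega)
  simp only [frV, h8, h9]
  rfl

/-- everything annihilated by the functionals is small -/
lemma ann_le (L : List (ℕ × ℕ)) (R : ℕ) (h : FC L R) (U : Submodule ℂ (Fin 8 × Fin 9 → ℂ))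
    (hU : ∀ u ∈ U, ∀ x ∈ L, ∀ p : Fin 10, lam x.2 (PsiP (phC x.1) p u) = 0) :
    finrank ℂ U + R ≤ 72 := by
  have h1 := F_rank L R h
  have h2 := pair_le U (DF L) (by
    intro u hu F hF
    induction hF using Submodule.span_induction with
    | mem v hv =>
      obtain ⟨x, hx, p, rfl⟩ := hv
      rw [← lam_frV]
      exact hU u hu x hx p
    | zero => simp
    | add x y _ _ hx hy =>
      simp only [Pi.add_apply, mul_add, Finset.sum_add_distrib, hx, hy, add_zero]
    | smul a x _ hx =>
      have : ∀ y, u y * (a • x) y = a * (u y * x y) := fun y => by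
        simp only [Pi.smul_apply, smul_eq_mul]; ring
      simp only [this, ← Finset.mul_sum, hx, mul_zero])
  simp only [Fintype.card_prod, Fintype.card_fin] at h2
  omega

end CWK
end

noncomputable section
namespace CWK
open Module

/-- tables of slices after deleting a slice on each of two factors -/
def TB4 : ℕ := 497202744666597889058094933019699871514361831589902118444203016593877499855892599341055
def TB5 : ℕ := 497202744666597889058094933025927933614514835118154424461398147754708983114240265617407
def TB8 : ℕ := 1755983559532871133784401228858852223904362229685733758476740405999201753437686815973827269676640171298369939030502509195699534821428820178436095

/-- projections to a five dimensional space together with functionals (base four digits) -/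
def LL5 : List (ℕ × ℕ) := [
  (5025213991408, 436922559126527125405341483474515465994240),
  (5025213991408, 548063113999091514993364738116064709802800971776),
  (1239906005089, 5809355018680390282548881522490192966732485128),
  (1239906005089, 91343852333235951900888149356902604938802635012),
  (11203486294044, 28544953860765337640481271001576839907389735426),
  (11203486294044, 91790087911679338414266747412169367495607599104),
  (14368067038729, 34967601843227035795750727087687159592096370697),
  (14368067038729, 365732575533710759458530847503478545296514351428),
  (4475477697265, 1361129467683763525260055346760470495232),
  (4475477697265, 348789426094004015011294675564569926696960)]

def LL8 : List (ℕ × ℕ) := [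
  (1208338040395, 92793400771085922891930124913082015893749235712),
  (1208338040395, 389752954990996135437696409084591479629723729920),
  (3045234983129, 356812604426612860661682458011620611094216961),
  (3045234983129, 22858263828493888730142348897247255954274123776),
  (4744540104208, 27222589353727689528739597327761779851264),
  (4744540104208, 89213869861017749947564969088745909969289792),
  (5025154646180, 87113615159756031562496875437555892355144),
  (5025154646180, 371588344677704416183262203503256392433664)]

set_option maxRecDepth 100000 in
theorem kc4 : KC 9347059189282 TB4 79 := by
  unfold KC
  decide +kernel

def PP5 : List ℕ := [5025213991408, 1239906005089, 11203486294044, 14368067038729, 4475477697265]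
def PP8 : List ℕ := [1208338040395, 3045234983129, 4744540104208, 5025154646180]

lemma mem5 : ∀ x ∈ LL5, x.1 ∈ PP5 := by decide +kernel
lemma mem8 : ∀ x ∈ LL8, x.1 ∈ PP8 := by decide +kernel

def LKC (L : List ℕ) (TB : ℕ) : Prop :=
  (L.all fun x => Nat.ble 78 (rk 100 ((rowsK x TB 9).map (mask 80)))) = true

set_option maxRecDepth 100000 in
theorem kc5 : LKC PP5 TB5 := by
  unfold LKC
  decide +kernel

set_option maxRecDepth 100000 in
theorem kc8 : LKC PP8 TB8 := by
  unfold LKC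
  decide +kernel

def LNu (L : List (ℕ × ℕ)) (TB n : ℕ) : Prop :=
  (L.all fun x => (List.range n).all fun a => (List.range 10).all fun p =>
    dotI x.1 x.2 TB a p == 0) = true

set_option maxRecDepth 100000 in
theorem nu5 : LNu LL5 TB5 9 := by
  unfold LNu
  decide +kernel

set_option maxRecDepth 100000 in
theorem nu8 : LNu LL8 TB8 15 := by
  unfold LNu
  decide +kernel

set_option maxRecDepth 100000 in
theorem fc5 : FC LL5 60 := by
  unfold FC
  decide +kernel

set_option maxRecDepth 100000 in
theorem fc8 : FC LL8 58 := by
  unfold FC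
  decide +kernel

lemma LKC_spec {L : List ℕ} {TB : ℕ} (h : LKC L TB) (x : ℕ) (hx : x ∈ L) : KC x TB 78 := by
  unfold LKC at h
  rw [List.all_eq_true] at h
  exact h x hx

lemma LNu_spec {L : List (ℕ × ℕ)} {TB n : ℕ} (h : LNu L TB n) (x : ℕ × ℕ) (hx : x ∈ L) :
    NuC x.1 x.2 TB n := by
  unfold LNu at h
  rw [List.all_eq_true] at h
  exact h x hx

def Tn (TB : ℕ) : Fin 9 → Fin 8 → Fin 9 → ℂ := fun a b c => vec TB a (b, c)

theorem case4 : ¬ BL (Tn TB4) 13 := by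
  intro h
  obtain ⟨f, -, hf, hg⟩ := E_lemma h (by simp)
  have hv : ∀ a : Fin 9, vec TB4 a ∈ Submodule.span ℂ (Set.range f) := hf
  obtain ⟨-, hle⟩ := W_le hg (PsiP (phC 9347059189282)) (PsiP_rankone _) (fun a : Fin 9 => vec TB4 a) hv
  have := K_rank _ _ _ kc4
  have h3 := this.trans hle
  norm_num at h3

theorem case5 : ¬ BL (Tn TB5) 13 := by
  intro h
  obtain ⟨f, hLI, hf, hg⟩ := E_lemma h (by simp)
  have hv : ∀ a : Fin 9, vec TB5 a ∈ Submodule.span ℂ (Set.range f) := hf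
  have h1 := ann_le LL5 60 fc5 (Submodule.span ℂ (Set.range f)) (fun u hu x hx p =>
    killed hg hv (LKC_spec kc5 x.1 (mem5 x hx)) le_rfl (LNu_spec nu5 x hx) p u hu)
  have h2 := finrank_span_eq_card hLI
  rw [Fintype.card_fin] at h2
  omega

end CWK
end

noncomputable section
namespace CWK
open Module

/-- coordinates of `Psi1` on a table vector -/
def p1I (TB a c i j b : ℕ) : ℤ :=
  Int.sub (bif Nat.beq (tab TB a b) i && Nat.beq c j then 1 else 0)
    (bif Nat.beq (tab TB a b) j && Nat.beq c i then 1 else 0)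

lemma p1I_eq (TB a : ℕ) (c i j : Fin 9) (b : Fin 8) :
    Psi1 c (vec TB a) (i, j, b) = (p1I TB a c i j b : ℂ) := by
  have hsub : ∀ x y : ℤ, Int.sub x y = x - y := fun x y => rfl
  show vec TB a (b, i) * _ - vec TB a (b, j) * _ = _
  simp only [p1I, vec, beq_dec, hsub, Fin.ext_iff]
  have gen : ∀ (A B C D : Prop) [Decidable A] [Decidable B] [Decidable C] [Decidable D],
      ((if A then (1:ℂ) else 0) * (if B then 1 else 0) - (if C then 1 else 0) * (if D then 1 else 0)) =
      (((bif decide A && decide B then 1 else 0) - (bif decide C && decide D then 1 else 0) : ℤ) : ℂ) := by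
    intro A B C D _ _ _ _
    by_cases hA : A <;> by_cases hB : B <;> by_cases hC : C <;> by_cases hD : D <;> simp [hA, hB, hC, hD]
  exact gen _ _ _ _

def q1 (c : ℕ) : ℕ := Nat.mod (Nat.shiftRight 10313731597845812321008419512119501095174144 (Nat.mul 4 c)) 16
def q2 (c : ℕ) : ℕ := Nat.mod (Nat.shiftRight 11888262322672735199326875992598113465746209 (Nat.mul 4 c)) 16

lemma q_lt : ∀ c < 36, q1 c < 9 ∧ q2 c < 9 := by decide

def row1 (TB a s : ℕ) : ℕ → ℤ := fun c =>
  p1I TB a s (q1 (Nat.div c 8)) (q2 (Nat.div c 8)) (Nat.mod c 8)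

def rows1 (TB : ℕ) : List (ℕ → ℤ) :=
  (List.range 15).flatMap fun a => (List.range 9).map fun s => row1 TB a s

def C1 (TB R : ℕ) : Prop := Nat.ble R (rk 150 ((rows1 TB).map (mask 288))) = true

set_option maxRecDepth 100000 in
theorem c1_8 : C1 TB8 112 := by
  unfold C1
  decide +kernel

lemma rank1 (TB R : ℕ) (h : C1 TB R) : R ≤ finrank ℂ (Submodule.span ℂ
    (Set.range fun x : Fin 15 × Fin 9 => Psi1 x.2 (vec TB x.1))) := by
  refine cert _ 288 (fun c => (Fin.ofNat 9 (q1 (c / 8)), Fin.ofNat 9 (q2 (c / 8)), Fin.ofNat 8 (c % 8)))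
    _ ?_ 150 R h
  intro r hr
  simp only [rows1, List.mem_flatMap, List.mem_map, List.mem_range] at hr
  obtain ⟨a, ha, p, hp, rfl⟩ := hr
  refine ⟨Psi1 ⟨p, hp⟩ (vec TB a), Submodule.subset_span ⟨(⟨a, ha⟩, ⟨p, hp⟩), rfl⟩, ?_⟩
  intro c hc
  rw [p1I_eq]
  have h8 : (Fin.ofNat 8 (c % 8)).val = c % 8 := Nat.mod_eq_of_lt (by omega)
  have h9 : (Fin.ofNat 9 (q2 (c / 8))).val = q2 (c / 8) := Nat.mod_eq_of_lt (q_lt _ (by omega)).2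
  have h7 : (Fin.ofNat 9 (q1 (c / 8))).val = q1 (c / 8) := Nat.mod_eq_of_lt (q_lt _ (by omega)).1
  rw [h8, h9, h7]
  rfl

def rowsV (TB : ℕ) : List (ℕ → ℤ) :=
  (List.range 15).map fun a => fun y => bif Nat.beq (tab TB a (Nat.div y 9)) (Nat.mod y 9) then 1 else 0

def CV (TB R : ℕ) : Prop := Nat.ble R (rk 20 ((rowsV TB).map (mask 72))) = true

set_option maxRecDepth 100000 in
theorem cv_8 : CV TB8 14 := by
  unfold CV
  decide +kernel

lemma rankV (TB R : ℕ) (h : CV TB R) : R ≤ finrank ℂ (Submodule.span ℂ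
    (Set.range fun a : Fin 15 => vec TB a)) := by
  refine cert _ 72 (fun y => (Fin.ofNat 8 (y / 9), Fin.ofNat 9 (y % 9))) _ ?_ 20 R h
  intro r hr
  simp only [rowsV, List.mem_map, List.mem_range] at hr
  obtain ⟨a, ha, rfl⟩ := hr
  refine ⟨vec TB a, Submodule.subset_span ⟨⟨a, ha⟩, rfl⟩, ?_⟩
  intro c hc
  have h8 : (Fin.ofNat 8 (c / 9)).val = c / 9 := Nat.mod_eq_of_lt (by omega)
  have h9 : (Fin.ofNat 9 (c % 9)).val = c % 9 := Nat.mod_eq_of_lt (by omega)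
  simp only [vec, h8, h9, beq_dec]
  by_cases h : tab TB a (c / 9) = c % 9
  · have h' : tab TB a (Nat.div c 9) = Nat.mod c 9 := h
    simp [h, h']
  · have h' : ¬ tab TB a (Nat.div c 9) = Nat.mod c 9 := h
    simp [h, h']

/-- a linear relation between the images -/
def Rel (TB : ℕ) (l : List (Fin 9 × Fin 15)) : Prop :=
  ∀ i j : Fin 9, ∀ b : Fin 8, (l.map fun x => p1I TB x.2 x.1 i j b).sum = 0

lemma Rel_spec {TB : ℕ} {l : List (Fin 9 × Fin 15)} (h : Rel TB l) :
    (l.map fun x => Psi1 (β := Fin 8) x.1 (vec TB x.2)).sum = 0 := by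
  have key : ∀ (l : List (Fin 9 × Fin 15)) (i j : Fin 9) (b : Fin 8),
      (l.map fun x => Psi1 (β := Fin 8) x.1 (vec TB x.2)).sum (i, j, b) =
        (((l.map fun x => p1I TB x.2 x.1 i j b).sum : ℤ) : ℂ) := by
    intro l i j b
    induction l with
    | nil => simp
    | cons x l ih => simp only [List.map_cons, List.sum_cons, Pi.add_apply, ih, p1I_eq, Int.cast_add]
  funext ⟨i, j, b⟩
  rw [key, h i j b]
  simp

/-- all the data needed for one of the extra vectors -/
def Dat (TB : ℕ) (k : Fin 15) (s1 s2 : Fin 9) (l1 l2 : List (Fin 9 × Fin 15)) : Prop :=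
  s1 ≠ s2 ∧ Rel TB ((s1, k) :: l1) ∧ Rel TB ((s2, k) :: l2) ∧
  (∀ x ∈ l1, x.2.val < 9 ∨ (x.1 ≠ s1 ∧ x.1 ≠ s2)) ∧ (∀ x ∈ l2, x.2.val < 9 ∨ (x.1 ≠ s1 ∧ x.1 ≠ s2))

instance (TB : ℕ) (k : Fin 15) (s1 s2 : Fin 9) (l1 l2 : List (Fin 9 × Fin 15)) :
    Decidable (Dat TB k s1 s2 l1 l2) := by
  unfold Dat Rel
  infer_instance

theorem dat9 : Dat TB8 9 8 6 [(2,12),(5,11)] [(8,7),(0,12),(2,1),(3,11),(5,4)] := by decide +kernel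
theorem dat10 : Dat TB8 10 8 2 [(6,14),(7,13)] [(8,5),(0,14),(6,3),(1,13),(7,4)] := by decide +kernel
theorem dat11 : Dat TB8 11 8 6 [] [(8,4),(2,13)] := by decide +kernel
theorem dat12 : Dat TB8 12 8 6 [] [(8,1),(5,13)] := by decide +kernel
theorem dat13 : Dat TB8 13 8 2 [] [(8,4),(6,11)] := by decide +kernel
theorem dat14 : Dat TB8 14 8 2 [] [(8,3),(7,11)] := by decide +kernel

lemma final8 {k : Fin 15} {s1 s2 : Fin 9} {l1 l2 : List (Fin 9 × Fin 15)} (hd : Dat TB8 k s1 s2 l1 l2)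
    {f : Fin 13 → (Fin 8 × Fin 9 → ℂ)} (hg : goodFam f)
    (hv : ∀ a : Fin 15, a.val < 9 → vec TB8 a ∈ Submodule.span ℂ (Set.range f))
    (hall : ∀ a : Fin 15, vec TB8 a ∈ Submodule.span ℂ (Set.range f) ⊔ Submodule.span ℂ {vec TB8 k}) :
    False := by
  obtain ⟨hs, r1, r2, m1, m2⟩ := hd
  set M := Submodule.span ℂ (Set.range fun p : Fin 13 × Fin 9 => Psi1 p.2 (f p.1)) with hM
  have hM104 : finrank ℂ M ≤ 13 * 8 := hg (Fin 9) _ (fun s => Psi1 s) 8 (fun v w => by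
    simpa using Psi1_rankone v w)
  set S : Finset (Fin 9 × Fin 9 × Fin 8 → ℂ) :=
    (((Finset.univ.erase s1).erase s2).image fun s => Psi1 s (vec TB8 k)) with hS
  have hS7 : finrank ℂ (Submodule.span ℂ (S : Set (Fin 9 × Fin 9 × Fin 8 → ℂ))) ≤ 7 := by
    refine (finrank_span_finset_le_card S).trans (Finset.card_image_le.trans ?_)
    rw [Finset.card_erase_of_mem (Finset.mem_erase.2 ⟨hs.symm, Finset.mem_univ _⟩),
      Finset.card_erase_of_mem (Finset.mem_univ _)]
    simp
  set N := M ⊔ Submodule.span ℂ (S : Set (Fin 9 × Fin 9 × Fin 8 → ℂ)) with hN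
  have hN111 : finrank ℂ N ≤ 111 := by
    have := Submodule.finrank_add_le_finrank_add_finrank M
      (Submodule.span ℂ (S : Set (Fin 9 × Fin 9 × Fin 8 → ℂ)))
    rw [← hN] at this
    omega
  have hE : ∀ s : Fin 9, ∀ e ∈ Submodule.span ℂ (Set.range f), Psi1 s e ∈ N := by
    intro s e he
    refine le_sup_left (a := M) ?_
    have h3 := Submodule.mem_map_of_mem (f := Psi1 s) he
    rw [← Submodule.span_image] at h3
    refine Submodule.span_mono ?_ h3
    rintro _ ⟨_, ⟨m, rfl⟩, rfl⟩
    exact ⟨(m, s), rfl⟩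
  have hgen : ∀ s : Fin 9, Psi1 s (vec TB8 k) ∈ N → ∀ a : Fin 15, Psi1 s (vec TB8 a) ∈ N := by
    intro s hk a
    obtain ⟨y, hy, z, hz, hyz⟩ := Submodule.mem_sup.1 (hall a)
    obtain ⟨c, rfl⟩ := Submodule.mem_span_singleton.1 hz
    rw [← hyz, map_add, map_smul]
    exact N.add_mem (hE s y hy) (N.smul_mem _ hk)
  have hne : ∀ s : Fin 9, s ≠ s1 → s ≠ s2 → Psi1 s (vec TB8 k) ∈ N := by
    intro s h1 h2
    refine (le_sup_right : _ ≤ N) (Submodule.subset_span ?_)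
    rw [hS, Finset.coe_image]
    exact ⟨s, by simp [h1, h2], rfl⟩
  have hrel : ∀ (s : Fin 9) (l : List (Fin 9 × Fin 15)), Rel TB8 ((s, k) :: l) →
      (∀ x ∈ l, x.2.val < 9 ∨ (x.1 ≠ s1 ∧ x.1 ≠ s2)) → Psi1 s (vec TB8 k) ∈ N := by
    intro s l hr hm
    have h := Rel_spec hr
    rw [List.map_cons, List.sum_cons] at h
    rw [eq_neg_of_add_eq_zero_left h]
    apply N.neg_mem
    apply list_sum_mem
    intro v hvv
    obtain ⟨x, hx, rfl⟩ := List.mem_map.1 hvv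
    rcases hm x hx with h9 | ⟨h1, h2⟩
    · exact hE _ _ (hv _ h9)
    · exact hgen _ (hne _ h1 h2) _
  have hle : Submodule.span ℂ (Set.range fun x : Fin 15 × Fin 9 => Psi1 x.2 (vec TB8 x.1)) ≤ N := by
    rw [Submodule.span_le]
    rintro _ ⟨⟨a, s⟩, rfl⟩
    apply hgen
    by_cases h1 : s = s1
    · rw [h1]; exact hrel s1 l1 r1 m1
    · by_cases h2 : s = s2
      · rw [h2]; exact hrel s2 l2 r2 m2
      · exact hne s h1 h2
  have := (rank1 _ _ c1_8).trans (Submodule.finrank_mono hle)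
  omega

theorem case8 : ¬ BL (Tn TB8) 13 := by
  intro h
  obtain ⟨f, hLI, hf, hg⟩ := E_lemma h (by simp)
  have hv : ∀ a : Fin 9, vec TB8 a ∈ Submodule.span ℂ (Set.range f) := hf
  have hv' : ∀ a : Fin 15, a.val < 9 → vec TB8 a ∈ Submodule.span ℂ (Set.range f) :=
    fun a ha => hv ⟨a, ha⟩
  set E := Submodule.span ℂ (Set.range f) with hE
  have hE13 : finrank ℂ E = 13 := by
    rw [hE, finrank_span_eq_card hLI, Fintype.card_fin]
  set V := Submodule.span ℂ (Set.range fun a : Fin 15 => vec TB8 a) with hV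
  have hU : finrank ℂ (E ⊔ V : Submodule ℂ _) ≤ 14 := by
    have := ann_le LL8 58 fc8 (E ⊔ V) (by
      intro u hu x hx p
      have : E ⊔ V ≤ LinearMap.ker ((lam x.2).comp (PsiP (phC x.1) p)) := by
        apply sup_le
        · intro e he
          exact killed hg hv (LKC_spec kc8 x.1 (mem8 x hx)) (by norm_num) (LNu_spec nu8 x hx) p e he
        · rw [hV, Submodule.span_le]
          rintro _ ⟨a, rfl⟩
          exact NuC_spec (LNu_spec nu8 x hx) a a.2 p
      exact this hu)
    omega
  have hex : ∃ k : Fin 15, vec TB8 k ∉ E := by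
    by_contra hno
    push Not at hno
    have : V ≤ E := by
      rw [hV, Submodule.span_le]
      rintro _ ⟨a, rfl⟩
      exact hno a
    have h1 := Submodule.finrank_mono this
    have h2 : 14 ≤ finrank ℂ V := rankV _ _ cv_8
    omega
  obtain ⟨k, hk⟩ := hex
  have hle : E ⊔ Submodule.span ℂ {vec TB8 k} ≤ E ⊔ V := by
    apply sup_le_sup_left
    rw [hV]
    apply Submodule.span_mono
    rintro _ rfl
    exact ⟨k, rfl⟩
  have hlt : E < E ⊔ Submodule.span ℂ {vec TB8 k} := by
    refine lt_of_le_of_ne le_sup_left fun h => hk ?_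
    rw [h]
    exact le_sup_right (a := E) (Submodule.mem_span_singleton_self _)
  have h14 := Submodule.finrank_lt_finrank_of_lt hlt
  have heq := Submodule.eq_of_le_of_finrank_le hle (by omega)
  have hall : ∀ a : Fin 15, vec TB8 a ∈ E ⊔ Submodule.span ℂ {vec TB8 k} := by
    intro a
    rw [heq]
    exact le_sup_right (a := E) (Submodule.subset_span ⟨a, rfl⟩)
  have hk9 : 9 ≤ k.val := by
    by_contra h9
    exact hk (hv' k (by omega))
  have hcases : k = 9 ∨ k = 10 ∨ k = 11 ∨ k = 12 ∨ k = 13 ∨ k = 14 := by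
    simp only [Fin.ext_iff]
    have := k.2
    show k.val = 9 ∨ k.val = 10 ∨ k.val = 11 ∨ k.val = 12 ∨ k.val = 13 ∨ k.val = 14
    omega
  rcases hcases with rfl | rfl | rfl | rfl | rfl | rfl
  · exact final8 dat9 hg hv' hall
  · exact final8 dat10 hg hv' hall
  · exact final8 dat11 hg hv' hall
  · exact final8 dat12 hg hv' hall
  · exact final8 dat13 hg hv' hall
  · exact final8 dat14 hg hv' hall

end CWK
end

noncomputable section
namespace CWK
open Module

def dist3 (i j k : Fin 3) : Prop := i ≠ j ∧ j ≠ k ∧ i ≠ k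

instance (i j k : Fin 3) : Decidable (dist3 i j k) := by
  unfold dist3
  infer_instance

def pd (i j k : Fin 3) : ℂ := if dist3 i j k then 1 else 0

def gm (i : Fin 3) : Fin (2+1) → ℂ := match i with
  | 0 => ![1, 0, 0]
  | 1 => ![0, 1, Complex.I]
  | 2 => ![0, 1/2, -Complex.I/2]

lemma gm_pd (i j k : Fin 3) :
    ∑ i', ∑ j', ∑ k', gm i i' * gm j j' * gm k k' * cw 2 i' j' k' = pd i j k := by
  have hI : Complex.I * Complex.I = -1 := Complex.I_mul_I
  fin_cases i <;> fin_cases j <;> fin_cases k <;>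
    simp [Fin.sum_univ_three, gm, cw, pd, dist3] <;>
    first
      | linear_combination (0 : ℂ) * hI
      | linear_combination (-1/2 : ℂ) * hI
      | linear_combination (1/4 : ℂ) * hI

def P3 : Fin 3 × Fin 3 → Fin 3 × Fin 3 → Fin 3 × Fin 3 → ℂ := kron pd pd

lemma BL_P3 {r : ℕ} (h : BL (kron (cw 2) (cw 2)) r) : BL P3 r := by
  have h1 := BL_tr (fun (i : Fin 3 × Fin 3) i' => gm i.1 i'.1 * gm i.2 i'.2)
    (fun (i : Fin 3 × Fin 3) i' => gm i.1 i'.1 * gm i.2 i'.2)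
    (fun (i : Fin 3 × Fin 3) i' => gm i.1 i'.1 * gm i.2 i'.2) h
  convert h1 using 1
  funext i j k
  simp only [P3, kron]
  rw [← gm_pd, ← gm_pd]
  simp only [Fintype.sum_prod_type, Finset.sum_mul_sum]
  refine Finset.sum_congr rfl fun i1 _ => Finset.sum_congr rfl fun i2 _ => Finset.sum_congr rfl fun j1 _ =>
    Finset.sum_congr rfl fun j2 _ => Finset.sum_congr rfl fun k1 _ => Finset.sum_congr rfl fun k2 _ => ?_
  ring

lemma P3_ne {i j k : Fin 3 × Fin 3} (h : P3 i j k ≠ 0) : dist3 i.1 j.1 k.1 ∧ dist3 i.2 j.2 k.2 := by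
  by_contra hc
  apply h
  simp only [P3, kron, pd]
  by_cases h1 : dist3 i.1 j.1 k.1
  · have h2 : ¬ dist3 i.2 j.2 k.2 := fun h2 => hc ⟨h1, h2⟩
    simp [h2]
  · simp [h1]

def wt (i : Fin 3) : ℕ := match i with
  | 0 => 0
  | 1 => 1
  | 2 => 3

def wt2 (i : Fin 3 × Fin 3) : ℕ := wt i.1 + 7 * wt i.2

lemma wt_sum : ∀ i j k : Fin 3, dist3 i j k → wt i + wt j + wt k = 4 := by decide

lemma wt2_inj : Function.Injective wt2 := by decide

lemma wt2_sum (i j k : Fin 3 × Fin 3) (h : P3 i j k ≠ 0) : wt2 i + wt2 j + wt2 k = 32 := by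
  obtain ⟨h1, h2⟩ := P3_ne h
  have := wt_sum _ _ _ h1
  have := wt_sum _ _ _ h2
  simp only [wt2]
  omega

def cut (i1 j1 : Fin 3 × Fin 3) : Fin 3 × Fin 3 → Fin 3 × Fin 3 → Fin 3 × Fin 3 → ℂ :=
  fun i j k => if i = i1 then 0 else if j = j1 then 0 else P3 i j k

lemma BL_cut (h : BL P3 15) : ∃ i1 j1, BL (cut i1 j1) 13 := by
  obtain ⟨j1, h1⟩ := torus (BL_swap h) wt2 wt2 wt2 32 (fun j i k hne => by
    have := wt2_sum i j k hne
    omega) wt2_inj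
  obtain ⟨i1, h2⟩ := torus (BL_swap h1) wt2 wt2 wt2 32 (fun i j k hne => by
    apply wt2_sum i j k
    intro h0
    rw [h0] at hne
    simp at hne) wt2_inj
  exact ⟨i1, j1, h2⟩

def rw9 (a : Fin 9) : Fin 3 := ⟨a.val / 3, by omega⟩
def cl9 (a : Fin 9) : Fin 3 := ⟨a.val % 3, by omega⟩

def cellP (a b c : Fin 9) : Prop := dist3 (rw9 a) (rw9 b) (rw9 c) ∧ dist3 (cl9 a) (cl9 b) (cl9 c)

instance (a b c : Fin 9) : Decidable (cellP a b c) := by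
  unfold cellP
  infer_instance

lemma red {i1 j1 : Fin 3 × Fin 3} (h : BL (cut i1 j1) 13) (f : Fin 9 → Fin 3 × Fin 3)
    (hf : Function.Injective f) (a1 : Fin 9) (hi : f a1 = i1) (hj : f 8 = j1)
    (hP : ∀ a b c, P3 (f a) (f b) (f c) = if cellP a b c then 1 else 0) (TB : ℕ)
    (hT : ∀ (a : Fin 9) (b : Fin 8) (c : Fin 9), tab TB a b = c ↔ (a ≠ a1 ∧ cellP a b.castSucc c)) :
    BL (Tn TB) 13 := by
  have h1 := BL_pull f (fun b : Fin 8 => f b.castSucc) f (fun _ => 1) (fun _ => 1) (fun _ => 1) h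
  convert h1 using 1
  funext a b c
  simp only [Tn, vec, cut, one_mul]
  have e1 : (f a = i1) ↔ a = a1 := by rw [← hi]; exact hf.eq_iff
  have e2 : ¬ (f b.castSucc = j1) := by
    rw [← hj, hf.eq_iff]
    intro h
    have := congrArg Fin.val h
    have h8 : b.castSucc.val = b.val := rfl
    have h9 : (8 : Fin 9).val = 8 := rfl
    omega
  simp only [e1, e2, if_false, hP, hT]
  by_cases ha : a = a1
  · simp [ha]
  · simp [ha]

set_option maxRecDepth 100000 in
lemma hT4 : ∀ (a : Fin 9) (b : Fin 8) (c : Fin 9), tab TB4 a b = c ↔ (a ≠ 4 ∧ cellP a b.castSucc c) := by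
  decide +kernel
set_option maxRecDepth 100000 in
lemma hT5 : ∀ (a : Fin 9) (b : Fin 8) (c : Fin 9), tab TB5 a b = c ↔ (a ≠ 5 ∧ cellP a b.castSucc c) := by
  decide +kernel
set_option maxRecDepth 100000 in
lemma hT8 : ∀ (a : Fin 9) (b : Fin 8) (c : Fin 9), tab TB8 a b = c ↔ (a ≠ 8 ∧ cellP a b.castSucc c) := by
  decide +kernel

lemma perm3 : ∀ i j : Fin 3, ∃ σ : Equiv.Perm (Fin 3), σ 2 = j ∧ (σ 2 = i ∨ σ 1 = i) := by decide +kernel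

lemma pd_perm (σ : Equiv.Perm (Fin 3)) (i j k : Fin 3) : dist3 (σ i) (σ j) (σ k) ↔ dist3 i j k := by
  simp [dist3]

lemma rc_inj : ∀ a b : Fin 9, rw9 a = rw9 b → cl9 a = cl9 b → a = b := by decide +kernel

def fA (σ τ : Equiv.Perm (Fin 3)) (a : Fin 9) : Fin 3 × Fin 3 := (σ (rw9 a), τ (cl9 a))
def fB (σ τ : Equiv.Perm (Fin 3)) (a : Fin 9) : Fin 3 × Fin 3 := (σ (cl9 a), τ (rw9 a))

lemma fA_inj (σ τ : Equiv.Perm (Fin 3)) : Function.Injective (fA σ τ) := by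
  intro a b h
  simp only [fA, Prod.mk.injEq, EmbeddingLike.apply_eq_iff_eq] at h
  exact rc_inj a b h.1 h.2

lemma fB_inj (σ τ : Equiv.Perm (Fin 3)) : Function.Injective (fB σ τ) := by
  intro a b h
  simp only [fB, Prod.mk.injEq, EmbeddingLike.apply_eq_iff_eq] at h
  exact rc_inj a b h.2 h.1

lemma fA_P (σ τ : Equiv.Perm (Fin 3)) (a b c : Fin 9) :
    P3 (fA σ τ a) (fA σ τ b) (fA σ τ c) = if cellP a b c then 1 else 0 := by
  simp only [P3, kron, fA, pd, pd_perm, cellP]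
  by_cases h1 : dist3 (rw9 a) (rw9 b) (rw9 c) <;> by_cases h2 : dist3 (cl9 a) (cl9 b) (cl9 c) <;> simp [h1, h2]

lemma fB_P (σ τ : Equiv.Perm (Fin 3)) (a b c : Fin 9) :
    P3 (fB σ τ a) (fB σ τ b) (fB σ τ c) = if cellP a b c then 1 else 0 := by
  simp only [P3, kron, fB, pd, pd_perm, cellP]
  by_cases h1 : dist3 (rw9 a) (rw9 b) (rw9 c) <;> by_cases h2 : dist3 (cl9 a) (cl9 b) (cl9 c) <;> simp [h1, h2]

theorem lower2 : ¬ BL (kron (cw 2) (cw 2)) 15 := by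
  intro h
  obtain ⟨i1, j1, hc⟩ := BL_cut (BL_P3 h)
  obtain ⟨σ, s1, s2⟩ := perm3 i1.1 j1.1
  obtain ⟨τ, t1, t2⟩ := perm3 i1.2 j1.2
  have hjA : fA σ τ 8 = j1 := Prod.ext s1 t1
  have hjB : fB σ τ 8 = j1 := Prod.ext s1 t1
  rcases s2 with s2 | s2 <;> rcases t2 with t2 | t2
  · exact case8 (red hc (fA σ τ) (fA_inj σ τ) 8 (Prod.ext s2 t2) hjA (fA_P σ τ) TB8 hT8)
  · exact case5 (red hc (fB σ τ) (fB_inj σ τ) 5 (Prod.ext s2 t2) hjB (fB_P σ τ) TB5 hT5)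
  · exact case5 (red hc (fA σ τ) (fA_inj σ τ) 5 (Prod.ext s2 t2) hjA (fA_P σ τ) TB5 hT5)
  · exact case4 (red hc (fA σ τ) (fA_inj σ τ) 4 (Prod.ext s2 t2) hjA (fA_P σ τ) TB4 hT4)

theorem lower (q : ℕ) (hq : 2 ≤ q) {r : ℕ} (h : BL (kron (cw q) (cw q)) r) : (q + 2) ^ 2 ≤ r := by
  by_contra hlt
  have h1 : BL (kron (cw q) (cw q)) ((q + 2) ^ 2 - 1) := BL_mono (by omega) h
  rcases Nat.lt_or_ge q 3 with h3 | h3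
  · have : q = 2 := by omega
    subst this
    exact lower2 h1
  · exact lower3 q h3 h1

theorem main (q : ℕ) (hq : 2 ≤ q) :
    brank (kron (cw q) (cw q)) = (q + 2) ^ 2 ∧ (q + 2) ^ 2 = (brank (cw q)) ^ 2 := by
  have hk : BL (kron (cw q) (cw q)) ((q + 2) ^ 2) := by
    rw [pow_two]
    exact BL_kron (BL_cw q) (BL_cw q)
  have e1 : brank (kron (cw q) (cw q)) = (q + 2) ^ 2 :=
    le_antisymm (Nat.sInf_le hk) (le_csInf ⟨_, hk⟩ fun r hr => lower q hq hr)
  have e2 : brank (cw q) = q + 2 := by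
    refine le_antisymm (Nat.sInf_le (BL_cw q)) (le_csInf ⟨_, BL_cw q⟩ fun r hr => ?_)
    have hr' : BL (cw q) r := hr
    have := lower q hq (BL_kron hr' hr')
    rw [← pow_two] at this
    exact (Nat.pow_le_pow_iff_left (by norm_num)).1 this
  exact ⟨e1, by rw [e2]⟩

end CWK
end

/-- for `q ≥ 2`, `BR(cw_q ⊠ cw_q) = (q+2)² = BR(cw_q)²`. -/
theorem borderRank_cw_kron_square (q : ℕ) (hq : 2 ≤ q) :
    brank (kron (cw q) (cw q)) = (q + 2) ^ 2 ∧ (q + 2) ^ 2 = (brank (cw q)) ^ 2 := by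
  exact CWK.main q hq

end
end

section
/- Let m ≥ 3 and let T ∈ ℂ^m⊗ℂ^m⊗ℂ^m be a 1-generic tensor of minimal border rank, i.e., BR(T) = m. Then T degenerates to the big Coppersmith–Winograd tensor: CW_{m−2} lies in the closure, in the Euclidean topology on ℂ^m⊗ℂ^m⊗ℂ^m, of the orbit {(g₁⊗g₂⊗g₃)(T) : g₁, g₂, g₃ ∈ GL_m(ℂ)}. -/
open scoped BigOperators

noncomputable section

open Matrix

/-- The contraction of `T` with `α` in the first slot. -/
def cA {m : ℕ} (T : Fin m → Fin m → Fin m → ℂ) (α : Fin m → ℂ) : Matrix (Fin m) (Fin m) ℂ :=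
  Matrix.of fun j k => ∑ i, α i * T i j k

/-- The contraction of `T` with `β` in the second slot. -/
def cB {m : ℕ} (T : Fin m → Fin m → Fin m → ℂ) (β : Fin m → ℂ) : Matrix (Fin m) (Fin m) ℂ :=
  Matrix.of fun i k => ∑ j, β j * T i j k

/-- The contraction of `T` with `γ` in the third slot. -/
def cC {m : ℕ} (T : Fin m → Fin m → Fin m → ℂ) (γ : Fin m → ℂ) : Matrix (Fin m) (Fin m) ℂ :=
  Matrix.of fun i j => ∑ k, γ k * T i j k

/-- The trilinear form of `T`. -/
def tri {m : ℕ} (T : Fin m → Fin m → Fin m → ℂ) (α β γ : Fin m → ℂ) : ℂ :=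
  ∑ i, ∑ j, ∑ k, α i * β j * γ k * T i j k

lemma tri_A {m : ℕ} (T : Fin m → Fin m → Fin m → ℂ) (α β γ : Fin m → ℂ) :
    tri T α β γ = β ⬝ᵥ cA T α *ᵥ γ := by
  simp only [tri, cA, dotProduct, mulVec, Matrix.of_apply, Finset.mul_sum, Finset.sum_mul]
  rw [Finset.sum_comm]
  refine Finset.sum_congr rfl fun j _ => ?_
  rw [Finset.sum_comm]
  refine Finset.sum_congr rfl fun k _ => Finset.sum_congr rfl fun i _ => ?_
  ring

lemma tri_B {m : ℕ} (T : Fin m → Fin m → Fin m → ℂ) (α β γ : Fin m → ℂ) :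
    tri T α β γ = α ⬝ᵥ cB T β *ᵥ γ := by
  simp only [tri, cB, dotProduct, mulVec, Matrix.of_apply, Finset.mul_sum, Finset.sum_mul]
  refine Finset.sum_congr rfl fun j _ => ?_
  rw [Finset.sum_comm]
  refine Finset.sum_congr rfl fun k _ => Finset.sum_congr rfl fun i _ => ?_
  ring

lemma tri_C {m : ℕ} (T : Fin m → Fin m → Fin m → ℂ) (α β γ : Fin m → ℂ) :
    tri T α β γ = α ⬝ᵥ cC T γ *ᵥ β := by
  simp only [tri, cC, dotProduct, mulVec, Matrix.of_apply, Finset.mul_sum, Finset.sum_mul]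
  refine Finset.sum_congr rfl fun j _ => Finset.sum_congr rfl fun k _ =>
    Finset.sum_congr rfl fun i _ => ?_
  ring

lemma isUnit_of_rank_eq {m : ℕ} (A : Matrix (Fin m) (Fin m) ℂ) (h : A.rank = m) : IsUnit A := by
  have h1 : LinearMap.range A.mulVecLin = ⊤ := by
    apply Submodule.eq_top_of_finrank_eq
    rw [Module.finrank_fin_fun]
    exact h
  rw [← Matrix.mulVec_surjective_iff_isUnit]
  exact LinearMap.range_eq_top.1 h1

lemma continuous_cA {m : ℕ} (α : Fin m → ℂ) :
    Continuous fun T : Fin m → Fin m → Fin m → ℂ => cA T α := by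
  unfold cA
  refine continuous_matrix fun j k => ?_
  simp only [Matrix.of_apply]
  fun_prop

lemma comm_of_rankLE {m : ℕ} (T : Fin m → Fin m → Fin m → ℂ) (h : rankLE T m)
    (a y z : Fin m → ℂ) :
    cA T y * (cA T a).adjugate * cA T z = cA T z * (cA T a).adjugate * cA T y := by
  obtain ⟨u, v, w, rfl⟩ := h
  let V : Matrix (Fin m) (Fin m) ℂ := Matrix.of fun j l => v l j
  let W : Matrix (Fin m) (Fin m) ℂ := Matrix.of fun l k => w l k
  have key : ∀ x : Fin m → ℂ, cA (fun i j k => ∑ l, u l i * v l j * w l k) x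
      = V * Matrix.diagonal (fun l => ∑ i, x i * u l i) * W := by
    intro x
    ext j k
    rw [Matrix.mul_apply]
    simp only [cA, Matrix.of_apply, Matrix.mul_diagonal, V, W, Finset.mul_sum, Finset.sum_mul]
    rw [Finset.sum_comm]
    refine Finset.sum_congr rfl fun l _ => Finset.sum_congr rfl fun i _ => ?_
    ring
  have hd : ∀ d : Fin m → ℂ, ∃ d', (Matrix.diagonal d).adjugate = Matrix.diagonal d' := by
    intro d
    exact ⟨_, Matrix.adjugate_diagonal d⟩
  simp only [key, Matrix.adjugate_mul_distrib]
  obtain ⟨d', hd'⟩ := hd (fun l => ∑ i, a i * u l i)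
  rw [hd']
  have e : ∀ D E : Matrix (Fin m) (Fin m) ℂ, V * D * W * (W.adjugate * (Matrix.diagonal d' * V.adjugate)) * (V * E * W)
      = (W.det * V.det) • (V * (D * Matrix.diagonal d' * E) * W) := by
    intro D E
    calc _ = V * D * (W * W.adjugate) * Matrix.diagonal d' * (V.adjugate * V) * E * W := by
          simp only [Matrix.mul_assoc]
      _ = _ := by
          rw [Matrix.mul_adjugate, Matrix.adjugate_mul]
          simp only [Matrix.mul_smul, Matrix.smul_mul, Matrix.mul_one, Matrix.mul_assoc, smul_smul]
          rw [mul_comm]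
  rw [e, e]
  simp only [Matrix.diagonal_mul_diagonal]
  congr 5
  ext l
  ring

lemma comm_of_closure {m : ℕ} (T : Fin m → Fin m → Fin m → ℂ)
    (h : T ∈ closure {S : Fin m → Fin m → Fin m → ℂ | rankLE S m}) (a y z : Fin m → ℂ) :
    cA T y * (cA T a).adjugate * cA T z = cA T z * (cA T a).adjugate * cA T y := by
  have hc : IsClosed {S : Fin m → Fin m → Fin m → ℂ |
      cA S y * (cA S a).adjugate * cA S z = cA S z * (cA S a).adjugate * cA S y} := by
    have h1 := continuous_cA y
    have h2 := continuous_cA z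
    have h3 := (continuous_cA a).matrix_adjugate
    exact isClosed_eq ((h1.mul h3).mul h2) ((h2.mul h3).mul h1)
  exact closure_minimal (fun S hS => comm_of_rankLE S hS a y z) hc h

lemma comm_inv {m : ℕ} (T : Fin m → Fin m → Fin m → ℂ)
    (h : T ∈ closure {S : Fin m → Fin m → Fin m → ℂ | rankLE S m}) (a y z : Fin m → ℂ) :
    cA T y * (cA T a)⁻¹ * cA T z = cA T z * (cA T a)⁻¹ * cA T y := by
  rw [Matrix.inv_def]
  simp only [Matrix.mul_smul, Matrix.smul_mul, comm_of_closure T h a y z]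

/-- If every unit of a finite dimensional commutative algebra has nonzero image under `φ`, then
the kernel of `φ` is an ideal. -/
lemma ker_ideal {R : Type*} [CommRing R] [Algebra ℂ R] [FiniteDimensional ℂ R] (φ : R →ₗ[ℂ] ℂ)
    (h : ∀ u : R, IsUnit u → φ u ≠ 0) (a r : R) (ha : φ a = 0) : φ (r * a) = 0 := by
  have : IsArtinianRing R := IsArtinianRing.of_finite ℂ R
  let K := LinearMap.ker φ
  let p : MaximalSpectrum R → Submodule ℂ K := fun M =>
    (M.asIdeal.restrictScalars ℂ).comap K.subtype
  have h1 : ∃ M, p M = ⊤ := by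
    by_contra! hne
    obtain ⟨x, hx⟩ := Submodule.exists_forall_notMem_of_forall_ne_top p hne
    refine h x.1 ?_ x.2
    by_contra hu
    obtain ⟨M, hM, hxM⟩ := exists_max_ideal_of_mem_nonunits hu
    exact hx ⟨M, hM⟩ hxM
  obtain ⟨M, hM⟩ := h1
  have hle : ∀ x, φ x = 0 → x ∈ M.asIdeal := by
    intro x hx
    have : (⟨x, hx⟩ : K) ∈ p M := by rw [hM]; trivial
    exact this
  have h2 : r * a ∈ M.asIdeal := M.asIdeal.mul_mem_left _ (hle a ha)
  by_contra hne
  apply M.isMaximal.ne_top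
  rw [Ideal.eq_top_iff_one]
  have h3 := hle (1 - (φ 1 / φ (r * a)) • (r * a)) (by
    simp [div_mul_cancel₀ _ hne])
  have h4 : (φ 1 / φ (r * a)) • (r * a) ∈ M.asIdeal :=
    (M.asIdeal.restrictScalars ℂ).smul_mem _ h2
  simpa using M.asIdeal.add_mem h3 h4

lemma exists_gamma {m : ℕ} (hm : 2 ≤ m) (T : Fin m → Fin m → Fin m → ℂ)
    (hcomm : ∀ a y z, cA T y * (cA T a)⁻¹ * cA T z = cA T z * (cA T a)⁻¹ * cA T y)
    (α β γ : Fin m → ℂ) (hα : IsUnit (cA T α)) (hβ : IsUnit (cB T β)) (hγ : IsUnit (cC T γ)) :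
    ∃ γ', IsUnit (cC T γ') ∧ tri T α β γ' = 0 := by
  have hdα := (Matrix.isUnit_iff_isUnit_det _).1 hα
  let X : (Fin m → ℂ) → Matrix (Fin m) (Fin m) ℂ := fun y => cA T y * (cA T α)⁻¹
  have hXm : ∀ y, X y * cA T α = cA T y := fun y => by
    simp only [X]
    rw [Matrix.mul_assoc, Matrix.nonsing_inv_mul _ hdα, Matrix.mul_one]
  have hX : ∀ a ∈ Set.range X, ∀ b ∈ Set.range X, a * b = b * a := by
    rintro _ ⟨y, rfl⟩ _ ⟨z, rfl⟩
    simp only [X]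
    rw [← Matrix.mul_assoc, hcomm, Matrix.mul_assoc]
  have hmc := Algebra.isMulCommutative_adjoin ℂ hX
  let R := Algebra.adjoin ℂ (Set.range X)
  open scoped IsMulCommutative in
  let _ : CommRing R := inferInstance
  let X' : (Fin m → ℂ) → R := fun y => ⟨X y, Algebra.subset_adjoin ⟨y, rfl⟩⟩
  have hcm : ∀ (a b : R), a.1 * b.1 = b.1 * a.1 := fun a b => congrArg Subtype.val (mul_comm a b)
  let φ : R →ₗ[ℂ] ℂ :=
    { toFun := fun r => β ⬝ᵥ r.1 *ᵥ (cA T α *ᵥ γ)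
      map_add' := fun a b => by
        change β ⬝ᵥ (a.1 + b.1) *ᵥ (cA T α *ᵥ γ) = _
        rw [Matrix.add_mulVec, dotProduct_add]
      map_smul' := fun c a => by simp [Matrix.smul_mulVec] }
  have hφ : ∀ r : R, φ r = β ⬝ᵥ r.1 *ᵥ (cA T α *ᵥ γ) := fun r => rfl
  by_cases hu : ∃ u : R, IsUnit u ∧ φ u = 0
  · obtain ⟨u, hu, h0⟩ := hu
    have hu' : IsUnit u.1 := hu.map R.val
    have hcg : cC T ((cA T α)⁻¹ *ᵥ (u.1 *ᵥ (cA T α *ᵥ γ))) = cC T γ * u.1ᵀ := by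
      refine Matrix.ext_iff_mulVec.2 fun z => dotProduct_eq _ _ fun y => ?_
      rw [dotProduct_comm, ← tri_C, dotProduct_comm, ← Matrix.mulVec_mulVec, ← tri_C,
        Matrix.mulVec_transpose, tri_A, tri_A, ← Matrix.dotProduct_mulVec, ← hXm y]
      simp only [Matrix.mulVec_mulVec]
      have h1 := hcm (X' y) u
      change X y * u.1 = u.1 * X y at h1
      have h2 : X y * cA T α * ((cA T α)⁻¹ * (u.1 * cA T α)) = u.1 * (X y * cA T α) := by
        calc _ = X y * (cA T α * (cA T α)⁻¹) * u.1 * cA T α := by simp only [Matrix.mul_assoc]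
          _ = _ := by
            rw [Matrix.mul_nonsing_inv _ hdα, Matrix.mul_one, h1, Matrix.mul_assoc]
      rw [h2]
    refine ⟨(cA T α)⁻¹ *ᵥ (u.1 *ᵥ (cA T α *ᵥ γ)), ?_, ?_⟩
    · rw [hcg]
      exact hγ.mul ((Matrix.isUnit_transpose _).2 hu')
    · rw [tri_A, Matrix.mulVec_mulVec, Matrix.mul_nonsing_inv _ hdα, Matrix.one_mulVec]
      exact h0
  · exfalso
    push Not at hu
    obtain ⟨y, hy0, hy⟩ : ∃ y : Fin m → ℂ, y ≠ 0 ∧ y ⬝ᵥ cB T β *ᵥ γ = 0 := by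
      let f : (Fin m → ℂ) →ₗ[ℂ] ℂ :=
        { toFun := fun y => y ⬝ᵥ cB T β *ᵥ γ
          map_add' := fun a b => by simp [add_dotProduct]
          map_smul' := fun c a => by simp [smul_dotProduct] }
      have hf : LinearMap.ker f ≠ ⊥ := by
        apply LinearMap.ker_ne_bot_of_finrank_lt
        rw [Module.finrank_fin_fun, Module.finrank_self]
        omega
      obtain ⟨y, hy, hy0⟩ := (Submodule.ne_bot_iff _).1 hf
      exact ⟨y, hy0, hy⟩
    have hXφ : φ (X' y) = 0 := by
      rw [hφ, ← hy, Matrix.mulVec_mulVec]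
      change β ⬝ᵥ (X y * cA T α) *ᵥ γ = _
      rw [hXm, ← tri_A, tri_B]
    have hall : ∀ z, tri T z (β ᵥ* X y) γ = 0 := by
      intro z
      have := ker_ideal φ hu (X' y) (X' z) hXφ
      rw [mul_comm, hφ] at this
      rw [tri_A, ← hXm, ← Matrix.dotProduct_mulVec, ← this]
      simp [X', Matrix.mulVec_mulVec, Matrix.mul_assoc]
    have hz : β ᵥ* X y = 0 := by
      have h1 : cC T γ *ᵥ (β ᵥ* X y) = 0 := by
        refine dotProduct_eq_zero _ fun w => ?_
        rw [dotProduct_comm, ← tri_C, hall]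
      exact Matrix.mulVec_injective_iff_isUnit.2 hγ (by rw [h1, Matrix.mulVec_zero])
    have hz2 : y ᵥ* cB T β = 0 := by
      refine dotProduct_eq_zero _ fun w => ?_
      rw [← Matrix.dotProduct_mulVec, ← tri_B, tri_A, ← hXm, ← Matrix.mulVec_mulVec,
        Matrix.dotProduct_mulVec, hz, zero_dotProduct]
    exact hy0 (Matrix.vecMul_injective_of_isUnit hβ (by simp only [hz2, Matrix.zero_vecMul]))

/-- The limit argument: a tensor agreeing with `bigCW` on the `0`-slices degenerates to it. -/
lemma limit_step {m : ℕ} (hm : 3 ≤ m) (T : Fin m → Fin m → Fin m → ℂ)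
    (g₁ g₂ g₃ : Matrix (Fin m) (Fin m) ℂ) (h₁ : IsUnit g₁) (h₂ : IsUnit g₂) (h₃ : IsUnit g₃)
    (h : ∀ i j k : Fin m, (i.val = 0 ∨ j.val = 0 ∨ k.val = 0) →
      triApply g₁ g₂ g₃ T i j k = bigCW m i j k) :
    bigCW m ∈ closure (glOrbit T) := by
  let w : Fin m → ℤ := fun i => if i.val = 0 then -2 else if i.val = m - 1 then 4 else 1
  let D : ℂ → Matrix (Fin m) (Fin m) ℂ := fun t => Matrix.diagonal fun i => t ^ w i
  have hD : ∀ t : ℂ, t ≠ 0 → IsUnit (D t) := by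
    intro t ht
    rw [Matrix.isUnit_iff_isUnit_det, Matrix.det_diagonal, isUnit_iff_ne_zero]
    exact Finset.prod_ne_zero_iff.2 fun i _ => zpow_ne_zero _ ht
  have hmem : ∀ t : ℂ, t ≠ 0 → triApply (D t * g₁) (D t * g₂) (D t * g₃) T ∈ glOrbit T :=
    fun t ht => ⟨_, _, _, (hD t ht).mul h₁, (hD t ht).mul h₂, (hD t ht).mul h₃, rfl⟩
  have hval : ∀ t : ℂ, t ≠ 0 → ∀ i j k, triApply (D t * g₁) (D t * g₂) (D t * g₃) T i j k
      = t ^ (w i + w j + w k) * triApply g₁ g₂ g₃ T i j k := by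
    intro t ht i j k
    simp only [triApply, D, Matrix.diagonal_mul, Finset.mul_sum, zpow_add₀ ht]
    refine Finset.sum_congr rfl fun _ _ => Finset.sum_congr rfl fun _ _ =>
      Finset.sum_congr rfl fun _ _ => ?_
    ring
  have hlim : Filter.Tendsto (fun t : ℂ => triApply (D t * g₁) (D t * g₂) (D t * g₃) T)
      (nhdsWithin 0 {0}ᶜ) (nhds (bigCW m)) := by
    refine tendsto_pi_nhds.2 fun i => tendsto_pi_nhds.2 fun j => tendsto_pi_nhds.2 fun k => ?_
    have hev : (fun t : ℂ => t ^ (w i + w j + w k) * triApply g₁ g₂ g₃ T i j k)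
        =ᶠ[nhdsWithin 0 {0}ᶜ]
        fun t => triApply (D t * g₁) (D t * g₂) (D t * g₃) T i j k := by
      filter_upwards [self_mem_nhdsWithin] with t ht
      exact (hval t ht i j k).symm
    refine Filter.Tendsto.congr' hev ?_
    by_cases h0 : i.val = 0 ∨ j.val = 0 ∨ k.val = 0
    · rw [h i j k h0]
      by_cases hb : bigCW m i j k = 0
      · simp [hb]
      · have hw : w i + w j + w k = 0 := by
          simp only [bigCW, ite_eq_right_iff, one_ne_zero, imp_false, not_not] at hb
          simp only [w]
          have e1 : ∀ a b : Fin m, a = b ↔ a.val = b.val := fun a b => Fin.ext_iff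
          simp only [e1] at hb
          split_ifs <;> omega
        simp [hw]
    · have hb : bigCW m i j k = 0 := by
        simp only [bigCW]
        rw [if_neg]
        tauto
      rw [hb]
      have hp : ∃ n : ℕ, n ≠ 0 ∧ w i + w j + w k = n := by
        refine ⟨(w i + w j + w k).toNat, ?_, ?_⟩ <;>
        · simp only [w]
          split_ifs <;> omega
      obtain ⟨n, hn, hn'⟩ := hp
      rw [hn']
      simp only [zpow_natCast]
      have : Filter.Tendsto (fun t : ℂ => t ^ n * triApply g₁ g₂ g₃ T i j k) (nhds 0)
          (nhds (0 ^ n * triApply g₁ g₂ g₃ T i j k)) := by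
        apply Continuous.tendsto (f := fun t : ℂ => t ^ n * triApply g₁ g₂ g₃ T i j k)
        fun_prop
      rw [zero_pow hn, zero_mul] at this
      exact this.mono_left nhdsWithin_le_nhds
  refine mem_closure_of_tendsto hlim ?_
  filter_upwards [self_mem_nhdsWithin] with t ht
  exact hmem t ht

lemma orthonormal_family {V : Type*} [AddCommGroup V] [Module ℂ V] [FiniteDimensional ℂ V]
    (B : LinearMap.BilinForm ℂ V) (hs : LinearMap.IsSymm B) (hnd : ∀ x, (∀ y, B x y = 0) → x = 0) :
    ∃ f : Fin (Module.finrank ℂ V) → V, ∀ i j, B (f i) (f j) = if i = j then 1 else 0 := by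
  obtain ⟨v, hv⟩ := LinearMap.BilinForm.exists_orthogonal_basis hs
  have hne : ∀ i, B (v i) (v i) ≠ 0 := by
    intro i hi
    apply v.ne_zero i
    apply hnd
    have : B (v i) = 0 := by
      refine v.ext fun j => ?_
      by_cases hij : i = j
      · subst hij; simpa using hi
      · exact hv hij
    intro y
    rw [this]; rfl
  choose c hc using fun i => IsAlgClosed.exists_eq_mul_self (B (v i) (v i))
  have hc0 : ∀ i, c i ≠ 0 := fun i h => hne i (by rw [hc, h, zero_mul])
  refine ⟨fun i => (c i)⁻¹ • v i, fun i j => ?_⟩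
  simp only [map_smul, LinearMap.smul_apply, smul_eq_mul]
  split_ifs with h
  · subst h
    rw [hc]
    have := hc0 i
    field_simp
  · have : B (v i) (v j) = 0 := hv h
    rw [this]; simp

lemma adapted_basis {m : ℕ} (hm : 3 ≤ m) (S : Matrix (Fin m) (Fin m) ℂ) (hS : IsUnit S)
    (hsym : S.IsSymm) (e : Fin m → ℂ) (he : e ≠ 0) (hee : e ⬝ᵥ S *ᵥ e = 0) :
    ∃ P : Matrix (Fin m) (Fin m) ℂ, IsUnit P ∧ P ⟨0, by omega⟩ = e ∧
      ∀ i j, P i ⬝ᵥ S *ᵥ P j = bigCW m ⟨0, by omega⟩ i j := by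
  let B : LinearMap.BilinForm ℂ (Fin m → ℂ) := Matrix.toBilin' S
  have hB : ∀ x y, B x y = x ⬝ᵥ S *ᵥ y := fun x y => Matrix.toBilin'_apply' S x y
  have hBs : ∀ x y, B x y = B y x := by
    intro x y
    rw [hB, hB, Matrix.dotProduct_mulVec, dotProduct_comm, ← Matrix.mulVec_transpose, hsym.eq]
  have hnd : ∀ x, (∀ y, B x y = 0) → x = 0 := by
    intro x hx
    have h1 : x ᵥ* S = 0 := dotProduct_eq_zero _ fun w => by
      rw [← Matrix.dotProduct_mulVec, ← hB, hx]
    exact Matrix.vecMul_injective_of_isUnit hS (by simp only [h1, Matrix.zero_vecMul])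
  have hee' : B e e = 0 := by rw [hB, hee]
  obtain ⟨s, hes, hss⟩ : ∃ s, B e s = 1 ∧ B s s = 0 := by
    obtain ⟨y, hy⟩ : ∃ y, B e y ≠ 0 := by
      by_contra! h
      exact he (hnd e h)
    let s₀ := (B e y)⁻¹ • y
    have h0 : B e s₀ = 1 := by simp [s₀, hy]
    have h0' : B s₀ e = 1 := by rw [hBs, h0]
    refine ⟨s₀ - (B s₀ s₀ / 2) • e, ?_, ?_⟩
    · simp [h0, hee']
    · simp only [map_sub, map_smul, LinearMap.sub_apply, LinearMap.smul_apply, smul_eq_mul,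
        h0, h0', hee']
      ring
  have hse : B s e = 1 := by rw [hBs, hes]
  let F : (Fin m → ℂ) →ₗ[ℂ] (ℂ × ℂ) := (B e).prod (B s)
  let W := LinearMap.ker F
  have hW : ∀ x, x ∈ W ↔ B e x = 0 ∧ B s x = 0 := by
    intro x
    simp [W, F]
  have hfr : m - 2 ≤ Module.finrank ℂ W := by
    have h1 := LinearMap.finrank_range_add_finrank_ker F
    have h2 := Submodule.finrank_le (LinearMap.range F)
    rw [Module.finrank_prod, Module.finrank_self] at h2
    rw [Module.finrank_fin_fun] at h1
    change m - 2 ≤ Module.finrank ℂ (LinearMap.ker F)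
    omega
  obtain ⟨f, hf⟩ := orthonormal_family (B.restrict W)
    ⟨fun x y => by simpa using hBs x.1 y.1⟩ (by
      intro x hx
      have hxW := (hW x.1).1 x.2
      have hex : B x.1 e = 0 := by rw [hBs]; exact hxW.1
      have hsx : B x.1 s = 0 := by rw [hBs]; exact hxW.2
      apply Subtype.ext
      apply hnd
      intro y
      have hz : y - B s y • e - B e y • s ∈ W := by
        rw [hW]
        simp [hee', hes, hss, hse]
      have h1 := hx ⟨_, hz⟩
      simpa [hex, hsx] using h1)
  have hf' : ∀ i j, B (f i).1 (f j).1 = if i = j then 1 else 0 := hf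
  have hef : ∀ i, B e (f i).1 = 0 := fun i => ((hW _).1 (f i).2).1
  have hsf : ∀ i, B s (f i).1 = 0 := fun i => ((hW _).1 (f i).2).2
  have hfe : ∀ i, B (f i).1 e = 0 := fun i => by rw [hBs, hef]
  have hfs : ∀ i, B (f i).1 s = 0 := fun i => by rw [hBs, hsf]
  let P : Matrix (Fin m) (Fin m) ℂ := fun i =>
    if h0 : i.val = 0 then e else if h1 : i.val = m - 1 then s else
      (f ⟨i.val - 1, by omega⟩).1
  have hP : ∀ i j, P i ⬝ᵥ S *ᵥ P j = bigCW m ⟨0, by omega⟩ i j := by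
    intro i j
    rw [← hB]
    have e1 : ∀ a b : Fin m, a = b ↔ a.val = b.val := fun a b => Fin.ext_iff
    simp only [P, bigCW]
    split_ifs with h1 h2 h3 h4 h5 h6 h7 h8 h9 h10 <;>
      simp only [hee', hes, hse, hss, hef, hsf, hfe, hfs, hf', Fin.mk.injEq, e1, true_and] at * <;>
      first
        | omega
        | rfl
        | (exfalso; omega)
        | (rw [if_pos]; omega)
        | (rw [if_neg]; omega)
  refine ⟨P, ?_, ?_, hP⟩
  · let J : Matrix (Fin m) (Fin m) ℂ := Matrix.of fun i j => bigCW m ⟨0, by omega⟩ i j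
    have h1 : P * S * Pᵀ = J := by
      ext i j
      rw [Matrix.mul_assoc]
      exact hP i j
    have hJ : IsUnit J := by
      let σ : Equiv.Perm (Fin m) := Equiv.swap ⟨0, by omega⟩ ⟨m - 1, by omega⟩
      have h2 : J = (1 : Matrix (Fin m) (Fin m) ℂ).submatrix σ (Equiv.refl _) := by
        ext i j
        have e1 : ∀ a b : Fin m, a = b ↔ a.val = b.val := fun a b => Fin.ext_iff
        simp only [J, bigCW, Matrix.of_apply, Matrix.submatrix_apply, Matrix.one_apply,
          Equiv.refl_apply, σ, Equiv.swap_apply_def]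
        refine if_congr ?_ rfl rfl
        simp only [e1, apply_ite Fin.val, true_and]
        split_ifs with h3 h4 <;> omega
      rw [h2, Matrix.isUnit_submatrix_equiv]
      exact isUnit_one
    rw [← h1, Matrix.mul_assoc] at hJ
    rw [Matrix.isUnit_iff_isUnit_det] at hJ ⊢
    rw [Matrix.det_mul] at hJ
    exact isUnit_of_mul_isUnit_left hJ
  · simp [P]

lemma triApply_eq_tri {m : ℕ} (T : Fin m → Fin m → Fin m → ℂ)
    (g₁ g₂ g₃ : Matrix (Fin m) (Fin m) ℂ) (i j k : Fin m) :
    triApply g₁ g₂ g₃ T i j k = tri T (g₁ i) (g₂ j) (g₃ k) := rfl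

lemma bigCW_perm {m : ℕ} (z i j : Fin m) (hz : z.val = 0) :
    bigCW m i z j = bigCW m z i j ∧ bigCW m i j z = bigCW m z i j := by
  have e1 : ∀ a b : Fin m, a = b ↔ a.val = b.val := fun a b => Fin.ext_iff
  simp only [bigCW, e1]
  constructor <;> refine if_congr ?_ rfl rfl <;> omega

lemma final_step {m : ℕ} (hm : 3 ≤ m) (T : Fin m → Fin m → Fin m → ℂ)
    (hcomm : ∀ a y z, cA T y * (cA T a)⁻¹ * cA T z = cA T z * (cA T a)⁻¹ * cA T y)
    (α β γ : Fin m → ℂ) (hα : IsUnit (cA T α)) (hβ : IsUnit (cB T β)) (hγ : IsUnit (cC T γ))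
    (h0 : tri T α β γ = 0) :
    bigCW m ∈ closure (glOrbit T) := by
  have hdα := (Matrix.isUnit_iff_isUnit_det _).1 hα
  have hdβ := (Matrix.isUnit_iff_isUnit_det _).1 hβ
  have hαi : IsUnit (cA T α)⁻¹ := Matrix.isUnit_nonsing_inv_iff.2 hα
  have hβi : IsUnit (cB T β)⁻¹ := Matrix.isUnit_nonsing_inv_iff.2 hβ
  -- `y ↦ y ᵥ* G` identifies the first factor with the second
  let G : Matrix (Fin m) (Fin m) ℂ := cB T β * (cA T α)⁻¹
  have hG : IsUnit G := hβ.mul hαi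
  let S : Matrix (Fin m) (Fin m) ℂ := cC T γ * Gᵀ
  have hS : IsUnit S := hγ.mul ((Matrix.isUnit_transpose _).2 hG)
  -- `y ↦ H *ᵥ y` identifies the first factor with the third
  let H : Matrix (Fin m) (Fin m) ℂ := (cB T β)⁻¹ * S
  have hH : IsUnit H := hβi.mul hS
  have t1 : ∀ y z, tri T α (y ᵥ* G) z = tri T y β z := by
    intro y z
    rw [tri_A, tri_B, ← Matrix.dotProduct_mulVec, Matrix.mulVec_mulVec]
    simp only [G]
    rw [Matrix.mul_assoc, Matrix.nonsing_inv_mul _ hdα, Matrix.mul_one]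
  have t2 : ∀ y z, tri T y (z ᵥ* G) γ = y ⬝ᵥ S *ᵥ z := by
    intro y z
    rw [tri_C, ← Matrix.mulVec_transpose, Matrix.mulVec_mulVec]
  have t3 : ∀ y z, tri T y β (H *ᵥ z) = y ⬝ᵥ S *ᵥ z := by
    intro y z
    rw [tri_B, Matrix.mulVec_mulVec]
    simp only [H]
    rw [← Matrix.mul_assoc, Matrix.mul_nonsing_inv _ hdβ, Matrix.one_mul]
  have t4 : ∀ y z, tri T y (z ᵥ* G) γ = β ⬝ᵥ (cA T z * (cA T α)⁻¹ * cA T y) *ᵥ γ := by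
    intro y z
    rw [tri_A, ← Matrix.dotProduct_mulVec, Matrix.mulVec_mulVec]
    simp only [G]
    rw [Matrix.mul_assoc, Matrix.mul_assoc, ← Matrix.mulVec_mulVec, ← tri_B, tri_A,
      Matrix.mulVec_mulVec]
  have hsymm : ∀ y z, y ⬝ᵥ S *ᵥ z = z ⬝ᵥ S *ᵥ y := by
    intro y z
    rw [← t2, ← t2, t4, t4, hcomm]
  have hSs : S.IsSymm := by
    refine Matrix.ext_iff_mulVec.2 fun z => dotProduct_eq _ _ fun y => ?_
    rw [Matrix.mulVec_transpose, ← Matrix.dotProduct_mulVec, hsymm, dotProduct_comm]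
  have hαG : α ᵥ* G = β := by
    refine Matrix.vecMul_injective_of_isUnit hα (dotProduct_eq _ _ fun z => ?_)
    change ((α ᵥ* G) ᵥ* cA T α) ⬝ᵥ z = (β ᵥ* cA T α) ⬝ᵥ z
    rw [← Matrix.dotProduct_mulVec (α ᵥ* G), ← Matrix.dotProduct_mulVec β, ← tri_A, ← tri_A, t1]
  have hHα : H *ᵥ α = γ := by
    refine Matrix.mulVec_injective_iff_isUnit.2 hβ (dotProduct_eq _ _ fun z => ?_)
    rw [dotProduct_comm, dotProduct_comm _ z, ← tri_B, ← tri_B, t3, ← t2, hαG]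
  have hα0 : α ≠ 0 := by
    intro h
    have : cA T α = 0 := by
      ext j k
      simp [cA, h]
    rw [this] at hdα
    have : Nonempty (Fin m) := ⟨⟨0, by omega⟩⟩
    simp at hdα
  have hαα : α ⬝ᵥ S *ᵥ α = 0 := by rw [← t2, hαG, h0]
  obtain ⟨P, hPu, hP0, hP⟩ := adapted_basis hm S hS hSs α hα0 hαα
  have r2 : ∀ j, (P * G) j = P j ᵥ* G := fun j => rfl
  have r3 : ∀ j, (P * Hᵀ) j = H *ᵥ P j := fun j => by
    rw [← Matrix.vecMul_transpose]; rfl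
  refine limit_step hm T P (P * G) (P * Hᵀ) hPu (hPu.mul hG)
    (hPu.mul ((Matrix.isUnit_transpose _).2 hH)) ?_
  intro i j k h
  have hz : ∀ i : Fin m, i.val = 0 → P i = α := by
    intro i hi
    have : i = ⟨0, by omega⟩ := Fin.ext hi
    rw [this, hP0]
  have hz' : ∀ i : Fin m, i.val = 0 → i = ⟨0, by omega⟩ := fun i hi => Fin.ext hi
  rw [triApply_eq_tri, r2, r3]
  rcases h with h | h | h
  · rw [hz i h, t1, t3, hP, hz' i h]
  · rw [hz j h, hαG, t3, hP, (bigCW_perm j i k h).1, hz' j h]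
  · rw [hz k h, hHα, t2, hP, (bigCW_perm k i j h).2, hz' k h]

/-- every 1-generic tensor `T ∈ ℂ^m⊗ℂ^m⊗ℂ^m` (`m ≥ 3`) of minimal border
rank degenerates to the big Coppersmith–Winograd tensor `CW_{m−2}`: the latter lies in the
closure of the `GL_m×GL_m×GL_m`-orbit of `T`. -/
theorem one_generic_minimal_border_rank_degenerates_to_CW
    (m : ℕ) (hm : 3 ≤ m) (T : Fin m → Fin m → Fin m → ℂ)
    (hT : oneGeneric T) (hbr : brank T = m) :
    bigCW m ∈ closure (glOrbit T) := by
  have hmem : T ∈ closure {S : Fin m → Fin m → Fin m → ℂ | rankLE S m} := by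
    have hne : {r | T ∈ closure {S : Fin m → Fin m → Fin m → ℂ | rankLE S r}}.Nonempty := by
      apply Nat.nonempty_of_pos_sInf
      change 0 < brank T
      omega
    have h1 := Nat.sInf_mem hne
    change T ∈ closure {S : Fin m → Fin m → Fin m → ℂ | rankLE S (brank T)} at h1
    rwa [hbr] at h1
  have hcomm := comm_inv T hmem
  obtain ⟨⟨α, hα⟩, ⟨β, hβ⟩, ⟨γ₀, hγ₀⟩⟩ := hT
  replace hα : IsUnit (cA T α) := isUnit_of_rank_eq _ hα
  replace hβ : IsUnit (cB T β) := isUnit_of_rank_eq _ hβ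
  replace hγ₀ : IsUnit (cC T γ₀) := isUnit_of_rank_eq _ hγ₀
  obtain ⟨γ, hγ, h0⟩ := exists_gamma (by omega) T hcomm α β γ₀ hα hβ hγ₀
  exact final_step hm T hcomm α β γ hα hβ hγ h0

end
end
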